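/- There exists a constant C > 0 such that for all sufficiently large n there exists an irreducible finite-dimensional complex representation V of the symmetric group S_n with the property that every irreducible finite-dimensional complex representation of S_n is a constituent of V ⊗ V ⊗ τ_n^{⊗ ⌈C·√n⌉}. -/

import Mathlib

open CategoryTheory MonoidalCategory

/-- `tpow V k` is the `k`-fold tensor power `V ⊗ ⋯ ⊗ V` in `FDRep ℂ G`. -/
noncomputable def tpow {G : Type} [Monoid G] (V : FDRep ℂ G) : ℕ → FDRep ℂ G
  | 0 => 𝟙_ (FDRep ℂ G)
  | k + 1 => tpow V k ⊗ V

/-- The standard permutation representation `τ_n` of `S_n` on `ℂ^n`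
(realised on `Fin n →₀ ℂ`, with `S_n` permuting the coordinates). -/
noncomputable def stdRep (n : ℕ) : FDRep ℂ (Equiv.Perm (Fin n)) :=
  FDRep.of (Representation.ofMulAction ℂ (Equiv.Perm (Fin n)) (Fin n))

set_option linter.unusedSectionVars false

open Equiv

/-- The sign of a permutation, as a complex number. -/
noncomputable def sg {α : Type} [Fintype α] [DecidableEq α] (a : Perm α) : ℂ :=
  ((Perm.sign a : ℤ) : ℂ)

section Sign

variable {α : Type} [Fintype α] [DecidableEq α]

@[simp] lemma sg_one : sg (1 : Perm α) = 1 := by simp [sg]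

@[simp] lemma sg_mul (a b : Perm α) : sg (a * b) = sg a * sg b := by simp [sg]

@[simp] lemma sg_inv (a : Perm α) : sg a⁻¹ = sg a := by simp [sg]

@[simp] lemma sg_mul_self (a : Perm α) : sg a * sg a = 1 := by
  unfold sg
  rcases Int.units_eq_one_or (Perm.sign a) with h | h <;> simp [h]

lemma sg_ne_zero (a : Perm α) : sg a ≠ 0 := fun h => by
  have := sg_mul_self a
  simp [h] at this

lemma conj_sg (a : Perm α) : (starRingEnd ℂ) (sg a) = sg a := by simp [sg]

end Sign

/-- The coefficient of the word `w` in the signed sum of the words `r ∘ a`, over the permutations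
`a` preserving the column labelling `c`. -/
noncomputable def ec {α : Type} [Fintype α] [DecidableEq α] (r c w : α → ℕ) : ℂ :=
  ∑ a : Perm α, if c ∘ a = c ∧ w = r ∘ a then sg a else 0

/-- The pair `(r, c)` of row and column labels is a bijection from `α` to the cells of `Y`. -/
structure IsTab {α : Type} (Y : YoungDiagram) (r c : α → ℕ) : Prop where
  inj : ∀ p q, r p = r q → c p = c q → p = q
  mem : ∀ p, (r p, c p) ∈ Y
  surj : ∀ i j, (i, j) ∈ Y → ∃ p, r p = i ∧ c p = j

lemma IsTab.transpose {α : Type} {Y : YoungDiagram} {r c : α → ℕ} (h : IsTab Y r c) :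
    IsTab Y.transpose c r where
  inj p q h1 h2 := h.inj p q h2 h1
  mem p := by simpa [YoungDiagram.mem_transpose] using h.mem p
  surj i j hij := by
    obtain ⟨p, h1, h2⟩ := h.surj j i (by simpa [YoungDiagram.mem_transpose] using hij)
    exact ⟨p, h2, h1⟩

lemma IsTab.comp {α β : Type} {Y : YoungDiagram} {r c : α → ℕ} (h : IsTab Y r c) (e : β ≃ α) :
    IsTab Y (r ∘ e) (c ∘ e) where
  inj p q h1 h2 := e.injective (h.inj _ _ h1 h2)
  mem p := h.mem (e p)
  surj i j hij := by
    obtain ⟨p, h1, h2⟩ := h.surj i j hij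
    exact ⟨e.symm p, by simpa using h1, by simpa using h2⟩

section Coefficient

variable {α : Type} [Fintype α] [DecidableEq α]

lemma conj_ec (r c w : α → ℕ) : (starRingEnd ℂ) (ec r c w) = ec r c w := by
  unfold ec
  rw [map_sum]
  exact Finset.sum_congr rfl fun a _ => by split_ifs <;> simp [conj_sg]

lemma ec_congr_col {r c c' : α → ℕ} (h : ∀ p q, c p = c q ↔ c' p = c' q) (w : α → ℕ) :
    ec r c w = ec r c' w := by
  unfold ec
  refine Finset.sum_congr rfl fun a _ => ?_
  have : c ∘ a = c ↔ c' ∘ a = c' := by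
    simp only [funext_iff, Function.comp]
    exact forall_congr' fun p => h _ _
  simp only [this]

lemma exists_of_ec_ne_zero {r c w : α → ℕ} (h : ec r c w ≠ 0) :
    ∃ a : Perm α, c ∘ a = c ∧ w = r ∘ a := by
  obtain ⟨a, -, ha⟩ := Finset.exists_ne_zero_of_sum_ne_zero h
  exact ⟨a, by by_contra hc; exact ha (if_neg hc)⟩

lemma ec_comp_right (r c w : α → ℕ) {a : Perm α} (ha : c ∘ a = c) :
    ec r c (w ∘ a) = sg a * ec r c w := by
  unfold ec
  rw [Finset.mul_sum, ← Equiv.sum_comp (Equiv.mulRight a)]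
  refine Finset.sum_congr rfl fun b _ => ?_
  have h1 : c ∘ (b * a : Perm α) = c ↔ c ∘ b = c := by
    constructor
    · intro h
      rw [Perm.coe_mul, ← Function.comp_assoc] at h
      exact a.surjective.injective_comp_right (h.trans ha.symm)
    · intro h
      rw [Perm.coe_mul, ← Function.comp_assoc, h, ha]
  have h2 : w ∘ a = r ∘ (b * a : Perm α) ↔ w = r ∘ b := by
    rw [Perm.coe_mul, ← Function.comp_assoc]
    exact a.surjective.injective_comp_right.eq_iff
  simp only [Equiv.coe_mulRight, h1, h2, sg_mul, mul_ite, mul_zero]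
  split_ifs <;> ring

/-- Transporting a tableau along a bijection. -/
lemma ec_comp_equiv {β : Type} [Fintype β] [DecidableEq β] (e : β ≃ α) (r c w : α → ℕ) :
    ec (r ∘ e) (c ∘ e) (w ∘ e) = ec r c w := by
  unfold ec
  rw [← Equiv.sum_comp (Equiv.permCongr e)]
  refine Finset.sum_congr rfl fun a _ => ?_
  have h0 : ∀ u : α → ℕ, u ∘ (Equiv.permCongr e a) = (u ∘ e) ∘ a ∘ e.symm := by
    intro u; ext p; simp [Equiv.permCongr_apply]
  have h1 : ∀ u v : α → ℕ, v = u ∘ (Equiv.permCongr e a) ↔ v ∘ e = (u ∘ e) ∘ a := by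
    intro u v
    rw [h0, ← e.surjective.injective_comp_right.eq_iff]
    simp [Function.comp_assoc]
  have h2 : sg (Equiv.permCongr e a) = sg a := by simp [sg]
  simp only [h1, h2, eq_comm (b := c)]
  simp only [eq_comm (b := c ∘ e)]

/-- The function `g ↦ ec r c (r ∘ g)` on permutations. -/
noncomputable def E (r c : α → ℕ) (g : Perm α) : ℂ := ec r c (r ∘ g)

lemma conj_E (r c : α → ℕ) (g : Perm α) : (starRingEnd ℂ) (E r c g) = E r c g := conj_ec _ _ _

lemma E_row_mul (r c : α → ℕ) {b : Perm α} (hb : r ∘ b = r) (g : Perm α) :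
    E r c (b * g) = E r c g := by
  unfold E
  rw [Perm.coe_mul, ← Function.comp_assoc, hb]

lemma E_mul_col (r c : α → ℕ) {a : Perm α} (ha : c ∘ a = c) (g : Perm α) :
    E r c (g * a) = sg a * E r c g := by
  unfold E
  rw [Perm.coe_mul, ← Function.comp_assoc, ec_comp_right r c _ ha]

lemma IsTab.E_one {Y : YoungDiagram} {r c : α → ℕ} (h : IsTab Y r c) : E r c 1 = 1 := by
  unfold E ec
  rw [Finset.sum_eq_single 1]
  · simp
  · intro a _ ha
    rw [if_neg]
    rintro ⟨h1, h2⟩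
    exact ha (Equiv.ext fun p => h.inj _ _ (congrFun h2 p).symm (congrFun h1 p))
  · simp

lemma sg_mul_E (r c : α → ℕ) (g : Perm α) : sg g * E r c g = E c r g⁻¹ := by
  unfold E ec
  rw [Finset.mul_sum]
  symm
  rw [← Equiv.sum_comp (Equiv.mulRight g⁻¹)]
  refine Finset.sum_congr rfl fun a _ => ?_
  have h1 : r ∘ (a * g⁻¹ : Perm α) = r ↔ r ∘ g = r ∘ a := by
    rw [← g.surjective.injective_comp_right.eq_iff]
    simp only [Function.comp_assoc, ← Perm.coe_mul, inv_mul_cancel_right]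
    exact eq_comm
  have h2 : c ∘ (g⁻¹ : Perm α) = c ∘ (a * g⁻¹ : Perm α) ↔ c ∘ a = c := by
    rw [Perm.coe_mul, ← Function.comp_assoc, (g⁻¹).surjective.injective_comp_right.eq_iff]
    exact eq_comm
  simp only [Equiv.coe_mulRight, h1, h2, sg_mul, sg_inv, mul_ite, mul_zero,
    and_comm (a := r ∘ g = r ∘ a)]
  split_ifs <;> ring

/-- Pairing with `E`, as a sum over row and column permutations. -/
lemma sum_E_inv_mul (r c : α → ℕ) (h : Perm α → ℂ) :
    ∑ g, E r c g⁻¹ * h g = ∑ a : Perm α, ∑ b : Perm α,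
      if c ∘ a = c ∧ r ∘ b = r then sg a * h (a * b) else 0 := by
  unfold E ec
  simp only [Finset.sum_mul]
  rw [Finset.sum_comm, ← Equiv.sum_comp (Equiv.inv (Perm α))]
  refine Finset.sum_congr rfl fun a _ => ?_
  rw [← Equiv.sum_comp (Equiv.mulLeft a)]
  refine Finset.sum_congr rfl fun b _ => ?_
  have h1 : c ∘ (a⁻¹ : Perm α) = c ↔ c ∘ a = c := by
    rw [← a.surjective.injective_comp_right.eq_iff]
    simp only [Function.comp_assoc, ← Perm.coe_mul, inv_mul_cancel]
    exact eq_comm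
  have h2 : r ∘ ((a * b)⁻¹ : Perm α) = r ∘ (a⁻¹ : Perm α) ↔ r ∘ b = r := by
    rw [← (a * b).surjective.injective_comp_right.eq_iff]
    simp only [Function.comp_assoc, ← Perm.coe_mul, inv_mul_cancel, inv_mul_cancel_left]
    exact eq_comm
  simp only [Equiv.inv_apply, Equiv.coe_mulLeft, h1, h2, sg_inv]
  split_ifs <;> simp

end Coefficient

section Dominance

open Finset

variable {α : Type} [Fintype α] [DecidableEq α]

lemma IsTab.card_col {Y : YoungDiagram} {r c : α → ℕ} (h : IsTab Y r c) (k v : ℕ) :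
    #{p | c p = v ∧ r p < k} = min k (Y.colLen v) := by
  rw [← card_range (min k (Y.colLen v))]
  refine card_nbij r ?_ ?_ ?_
  · intro p hp
    simp only [mem_filter, mem_univ, true_and, mem_coe, mem_range, lt_min_iff] at hp ⊢
    exact ⟨hp.2, YoungDiagram.mem_iff_lt_colLen.1 (hp.1 ▸ h.mem p)⟩
  · intro p hp q hq hpq
    simp only [coe_filter, mem_univ, true_and, Set.mem_ofPred_eq] at hp hq
    exact h.inj p q hpq (hp.1.trans hq.1.symm)
  · intro i hi
    simp only [coe_range, Set.mem_Iio, lt_min_iff] at hi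
    obtain ⟨p, h1, h2⟩ := h.surj i v (YoungDiagram.mem_iff_lt_colLen.2 hi.2)
    exact ⟨p, by simp [h1, h2, hi.1], h1⟩

lemma IsTab.card_col_le {Y : YoungDiagram} {r c : α → ℕ} (h : IsTab Y r c) {w : α → ℕ}
    (hw : ∀ p q, c p = c q → w p = w q → p = q) (k v : ℕ) :
    #{p | c p = v ∧ w p < k} ≤ min k (Y.colLen v) := by
  refine le_min ?_ ?_
  · rw [← card_range k]
    refine card_le_card_of_injOn w (fun p hp => ?_) fun p hp q hq hpq => ?_
    · simp only [coe_filter, mem_univ, true_and, Set.mem_ofPred_eq] at hp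
      simpa using hp.2
    · simp only [coe_filter, mem_univ, true_and, Set.mem_ofPred_eq] at hp hq
      exact hw p q (hp.1.trans hq.1.symm) hpq
  · rw [← card_range (Y.colLen v)]
    refine card_le_card_of_injOn r (fun p hp => ?_) fun p hp q hq hpq => ?_
    · simp only [coe_filter, mem_univ, true_and, Set.mem_ofPred_eq] at hp
      simpa using YoungDiagram.mem_iff_lt_colLen.1 (hp.1 ▸ h.mem p)
    · simp only [coe_filter, mem_univ, true_and, Set.mem_ofPred_eq] at hp hq
      exact h.inj p q hpq (hp.1.trans hq.1.symm)

lemma card_lt_eq_sum (c w : α → ℕ) (k : ℕ) :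
    #{p | w p < k} = ∑ v ∈ univ.image c, #{p | c p = v ∧ w p < k} := by
  rw [card_eq_sum_card_fiberwise (f := c) (t := univ.image c)
    (fun p _ => by simp)]
  refine sum_congr rfl fun v _ => ?_
  rw [filter_filter]
  simp only [and_comm]

lemma IsTab.dominance {Y : YoungDiagram} {r c : α → ℕ} (h : IsTab Y r c) {w : α → ℕ}
    (hw : ∀ p q, c p = c q → w p = w q → p = q) (k : ℕ) :
    #{p | w p < k} ≤ #{p | r p < k} := by
  rw [card_lt_eq_sum c w, card_lt_eq_sum c r]
  exact sum_le_sum fun v _ => by rw [h.card_col]; exact h.card_col_le hw k v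

lemma IsTab.exists_perm {Y : YoungDiagram} {r c : α → ℕ} (h : IsTab Y r c) {w : α → ℕ}
    (hw : ∀ p q, c p = c q → w p = w q → p = q) (hk : ∀ k, #{p | w p < k} = #{p | r p < k}) :
    ∃ a : Perm α, c ∘ a = c ∧ w = r ∘ a := by
  have key : ∀ k, ∀ v ∈ univ.image c, #{p | c p = v ∧ w p < k} = min k (Y.colLen v) := by
    intro k
    have h1 := hk k
    rw [card_lt_eq_sum c w, card_lt_eq_sum c r] at h1
    simp only [h.card_col] at h1
    exact (sum_eq_sum_iff_of_le fun v _ => h.card_col_le hw k v).1 h1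
  have mem : ∀ p, (w p, c p) ∈ Y := by
    intro p
    rw [YoungDiagram.mem_iff_lt_colLen]
    by_contra! hlt
    have h1 := key (w p) (c p) (by simp)
    have h2 := key (w p + 1) (c p) (by simp)
    rw [min_eq_right hlt] at h1
    rw [min_eq_right (by lia), ← h1] at h2
    refine absurd h2 (ne_of_gt (card_lt_card ?_))
    refine ⟨fun q hq => ?_, fun hs => ?_⟩
    · simp only [mem_filter, mem_univ, true_and] at hq ⊢
      exact ⟨hq.1, by lia⟩
    · have := @hs p (by simp)
      simp at this
  choose f hf1 hf2 using fun p => h.surj _ _ (mem p)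
  have hf : Function.Injective f := fun p q hpq =>
    hw p q (by rw [← hf2 p, ← hf2 q, hpq]) (by rw [← hf1 p, ← hf1 q, hpq])
  refine ⟨Equiv.ofBijective f (Finite.injective_iff_bijective.1 hf), funext hf2, ?_⟩
  exact funext fun p => (hf1 p).symm

lemma card_comp_perm (g : Perm α) (r : α → ℕ) (k : ℕ) :
    #{p | (r ∘ g) p < k} = #{p | r p < k} := by
  refine card_equiv g fun p => by simp

/-- The rows of two labels in one column coincide after `g`, so that `f g = 0` for `f` with the
symmetries of `E`. -/
lemma eq_zero_of_collision {r c : α → ℕ} {f : Perm α → ℂ}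
    (h1 : ∀ (b g : Perm α), r ∘ b = r → f (b * g) = f g)
    (h2 : ∀ (a g : Perm α), c ∘ a = c → f (g * a) = sg a * f g)
    {g : Perm α} {p q : α} (hpq : p ≠ q) (hc : c p = c q) (hr : r (g p) = r (g q)) : f g = 0 := by
  have e1 : g * swap p q = swap (g p) (g q) * g := by
    rw [mul_swap_eq_swap_mul]
  have e2 : c ∘ swap p q = c := by
    funext x
    rcases eq_or_ne x p with rfl | hx
    · simp [hc]
    rcases eq_or_ne x q with rfl | hx'
    · simp [hc]
    simp [swap_apply_of_ne_of_ne hx hx']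
  have e3 : r ∘ swap (g p) (g q) = r := by
    funext x
    rcases eq_or_ne x (g p) with rfl | hx
    · simp [hr]
    rcases eq_or_ne x (g q) with rfl | hx'
    · simp [hr]
    simp [swap_apply_of_ne_of_ne hx hx']
  have e4 := h2 _ g e2
  rw [e1, h1 _ _ e3] at e4
  have : sg (swap p q) = -1 := by simp [sg, Perm.sign_swap hpq]
  rw [this] at e4
  linear_combination e4 / 2

/-- Functions with the symmetries of `E` are multiples of `E`. -/
theorem IsTab.eq_smul_E {Y : YoungDiagram} {r c : α → ℕ} (h : IsTab Y r c) {f : Perm α → ℂ}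
    (h1 : ∀ (b g : Perm α), r ∘ b = r → f (b * g) = f g)
    (h2 : ∀ (a g : Perm α), c ∘ a = c → f (g * a) = sg a * f g)
    (g : Perm α) : f g = f 1 * E r c g := by
  by_cases hcol : ∃ p q, p ≠ q ∧ c p = c q ∧ r (g p) = r (g q)
  · obtain ⟨p, q, hpq, hc, hr⟩ := hcol
    rw [eq_zero_of_collision h1 h2 hpq hc hr, eq_zero_of_collision
      (fun b g hb => E_row_mul r c hb g) (fun a g ha => E_mul_col r c ha g) hpq hc hr, mul_zero]
  · push Not at hcol
    obtain ⟨a, ha, hga⟩ := h.exists_perm (w := r ∘ g)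
      (fun p q hc hr => by by_contra hpq; exact hcol p q hpq hc hr) (card_comp_perm g r)
    have hb : r ∘ (g * a⁻¹ : Perm α) = r := by
      rw [Perm.coe_mul, ← Function.comp_assoc, hga, Function.comp_assoc, ← Perm.coe_mul]
      simp
    have hg : g = (g * a⁻¹) * (1 * a) := by simp
    rw [hg, h1 _ _ hb, h2 _ _ ha, E_row_mul r c hb, E_mul_col r c ha, h.E_one]
    ring

lemma IsTab.sum_E_sq {Y : YoungDiagram} {r c : α → ℕ} (h : IsTab Y r c) :
    ∑ g, E r c g * E r c g ≠ 0 := by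
  have e : ∀ g, E r c g * E r c g = ((‖E r c g‖ ^ 2 : ℝ) : ℂ) := fun g => by
    rw [← Complex.normSq_eq_norm_sq, Complex.normSq_eq_conj_mul_self, conj_E]
  simp only [e]
  rw [← Complex.ofReal_sum, Complex.ofReal_ne_zero]
  refine (sum_pos' (fun g _ => by positivity) ⟨1, mem_univ _, ?_⟩).ne'
  rw [h.E_one]
  norm_num

/-- `E` at inverses is a combination of translates of `E`. -/
theorem IsTab.inv_mem_span {Y : YoungDiagram} {r c : α → ℕ} (h : IsTab Y r c) :
    (fun g => E r c g⁻¹) ∈ Submodule.span ℂ {f | ∃ x y, f = fun g => E r c (x * g * y)} := by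
  have hne : ∃ x y, ∑ m, E r c m⁻¹ * E r c (x * m * y) ≠ 0 := by
    by_contra! hz
    set k : Perm α → ℂ := fun u => ∑ g, E r c g * E r c (g * u) with hk
    have hkc : ∀ u, (starRingEnd ℂ) (k u) = k u := fun u => by simp [hk, conj_E]
    have hsum : ∑ u, k u * k u = 0 := by
      have : ∑ u, k u * k u = ∑ x, ∑ y, E r c x * E r c y *
          ∑ m, E r c m⁻¹ * E r c (x * m * y) := by
        simp only [hk, sum_mul_sum]
        calc ∑ u, ∑ g, ∑ x, E r c g * E r c (g * u) * (E r c x * E r c (x * u))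
            = ∑ g, ∑ u, ∑ x, E r c g * E r c (g * u) * (E r c x * E r c (x * u)) := sum_comm
          _ = ∑ g, ∑ y, ∑ x, E r c g * E r c y * (E r c x * E r c (x * (g⁻¹ * y))) := by
              refine sum_congr rfl fun g _ => ?_
              rw [← Equiv.sum_comp (Equiv.mulLeft g⁻¹)]
              simp
          _ = ∑ m, ∑ y, ∑ x, E r c m⁻¹ * E r c y * (E r c x * E r c (x * m * y)) := by
              rw [← Equiv.sum_comp (Equiv.inv (Perm α))]
              simp [mul_assoc]
          _ = _ := by
              rw [sum_comm, sum_congr rfl fun y _ => sum_comm, sum_comm]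
              refine sum_congr rfl fun x _ => sum_congr rfl fun y _ => ?_
              rw [mul_sum]
              exact sum_congr rfl fun m _ => by ring
      rw [this]
      simp [hz]
    have e : ∀ u, k u * k u = ((‖k u‖ ^ 2 : ℝ) : ℂ) := fun g => by
      rw [← Complex.normSq_eq_norm_sq, Complex.normSq_eq_conj_mul_self, hkc]
    simp only [e] at hsum
    rw [← Complex.ofReal_sum, Complex.ofReal_eq_zero,
      sum_eq_zero_iff_of_nonneg (fun _ _ => by positivity)] at hsum
    have h1 := hsum 1 (mem_univ _)
    simp only [pow_eq_zero_iff two_ne_zero, norm_eq_zero] at h1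
    exact h.sum_E_sq (by simpa [hk] using h1)
  obtain ⟨x, y, hxy⟩ := hne
  set F : Perm α → ℂ := fun g => ∑ a : Perm α, ∑ b : Perm α,
      if c ∘ a = c ∧ r ∘ b = r then sg a * E r c (x * (a * g⁻¹ * b) * y) else 0 with hF
  have hF1 : F 1 = ∑ m, E r c m⁻¹ * E r c (x * m * y) := by
    rw [sum_E_inv_mul r c (fun m => E r c (x * m * y))]
    simp [hF]
  have hFE : ∀ g, F g = F 1 * E r c g := by
    refine h.eq_smul_E (fun b g hb => ?_) (fun a g ha => ?_)
    · simp only [hF]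
      refine sum_congr rfl fun a _ => ?_
      rw [← Equiv.sum_comp (Equiv.mulLeft b)]
      refine sum_congr rfl fun b' _ => ?_
      have : r ∘ (b * b' : Perm α) = r ↔ r ∘ b' = r := by
        rw [Perm.coe_mul, ← Function.comp_assoc, hb]
      simp only [Equiv.coe_mulLeft, this]
      simp [mul_assoc]
    · simp only [hF, mul_sum]
      rw [← Equiv.sum_comp (Equiv.mulRight a)]
      refine sum_congr rfl fun a' _ => ?_
      refine sum_congr rfl fun b' _ => ?_
      have : c ∘ (a' * a : Perm α) = c ↔ c ∘ a' = c := by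
        constructor
        · intro h
          rw [Perm.coe_mul, ← Function.comp_assoc] at h
          exact a.surjective.injective_comp_right (h.trans ha.symm)
        · intro h
          rw [Perm.coe_mul, ← Function.comp_assoc, h, ha]
      simp only [Equiv.coe_mulRight, this, sg_mul]
      split_ifs <;> simp [mul_assoc, mul_left_comm]
  rw [← hF1] at hxy
  have h1 : (fun g => E r c g⁻¹) = (F 1)⁻¹ • ∑ a : Perm α, ∑ b : Perm α,
      if c ∘ a = c ∧ r ∘ b = r then sg a • fun g => E r c (x * a * g * (b * y)) else 0 := by
    funext g
    rw [← inv_mul_cancel_left₀ hxy (E r c g⁻¹), ← hFE g⁻¹]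
    simp only [hF, Pi.smul_apply, Finset.sum_apply, smul_eq_mul]
    congr 1
    refine sum_congr rfl fun a _ => sum_congr rfl fun b _ => ?_
    split_ifs <;> simp [mul_assoc]
  rw [h1]
  refine Submodule.smul_mem _ _ (Submodule.sum_mem _ fun a _ => Submodule.sum_mem _ fun b _ => ?_)
  split_ifs
  · exact Submodule.smul_mem _ _ (Submodule.subset_span ⟨_, _, rfl⟩)
  · exact zero_mem _

end Dominance

/-- The translates of the functions `E` over the tableaux of shape `Y` on `α`. -/
def Fam (α : Type) [Fintype α] [DecidableEq α] (Y : YoungDiagram) : Set (Perm α → ℂ) :=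
  {f | ∃ r c, IsTab Y r c ∧ ∃ x : Perm α, f = fun g => E r c (x * g)}

/-- Three shapes are `Linked` when some product of translates of `E` has nonzero sum, that is, when
the Kronecker coefficient of the three shapes does not vanish. -/
def Linked (Y : Fin 3 → YoungDiagram) : Prop :=
  ∃ (α : Type) (_ : Fintype α) (_ : DecidableEq α) (f : Fin 3 → Perm α → ℂ),
    (∀ i, f i ∈ Fam α (Y i)) ∧ ∑ g, ∏ i, f i g ≠ 0

section Basic

variable {α : Type} [Fintype α] [DecidableEq α]

lemma E_mul_right (r c : α → ℕ) (g y : Perm α) :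
    E r c (g * y) = E (r ∘ (y⁻¹ : Perm α)) (c ∘ (y⁻¹ : Perm α)) (y * g) := by
  unfold E
  rw [← ec_comp_equiv (y⁻¹ : Perm α)]
  congr 1
  ext p
  simp

lemma IsTab.translate_mem_fam {Y : YoungDiagram} {r c : α → ℕ} (h : IsTab Y r c) (x y : Perm α) :
    (fun g => E r c (x * g * y)) ∈ Fam α Y :=
  ⟨_, _, h.comp (y⁻¹ : Perm α), y * x, funext fun g => by rw [E_mul_right, mul_assoc]⟩

lemma sg_mul_mem_span_fam {Y : YoungDiagram} {f : Perm α → ℂ} (hf : f ∈ Fam α Y) :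
    (fun g => sg g * f g) ∈ Submodule.span ℂ (Fam α Y.transpose) := by
  obtain ⟨r, c, h, x, rfl⟩ := hf
  have h1 : (fun g => sg g * E r c (x * g)) =
      sg x • LinearMap.funLeft ℂ ℂ (x * ·) (fun g => E c r g⁻¹) := by
    funext g
    simp only [Pi.smul_apply, smul_eq_mul, LinearMap.funLeft_apply, ← sg_mul_E, sg_mul]
    linear_combination (- sg g * E r c (x * g)) * sg_mul_self x
  rw [h1]
  refine Submodule.smul_mem _ _ ?_
  have h2 := Submodule.mem_map_of_mem (f := LinearMap.funLeft ℂ ℂ (x * ·)) h.transpose.inv_mem_span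
  rw [Submodule.map_span] at h2
  refine Submodule.span_mono ?_ h2
  rintro _ ⟨_, ⟨u, v, rfl⟩, rfl⟩
  have := h.transpose.translate_mem_fam (u * x) v
  simpa [LinearMap.funLeft, Function.comp_def, mul_assoc] using this

lemma exists_ne_zero_of_mem_span {M : Type} [AddCommGroup M] [Module ℂ M] {S : Set M} {f : M}
    (hf : f ∈ Submodule.span ℂ S) (L : M →ₗ[ℂ] ℂ) (hL : L f ≠ 0) : ∃ s ∈ S, L s ≠ 0 := by
  by_contra! hs
  have : Submodule.span ℂ S ≤ LinearMap.ker L := Submodule.span_le.2 hs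
  exact hL (this hf)

/-- Multiplying by `h` and summing, as a linear functional. -/
noncomputable def pairing (h : Perm α → ℂ) : (Perm α → ℂ) →ₗ[ℂ] ℂ where
  toFun f := ∑ g, h g * f g
  map_add' f f' := by simp [mul_add, Finset.sum_add_distrib]
  map_smul' a f := by
    simp only [Pi.smul_apply, smul_eq_mul, RingHom.id_apply, Finset.mul_sum]
    exact Finset.sum_congr rfl fun g _ => by ring

lemma pairing_apply (h f : Perm α → ℂ) : pairing h f = ∑ g, h g * f g := rfl

end Basic

lemma Linked.transpose {Y₀ Y₁ Y₂ : YoungDiagram} (h : Linked ![Y₀, Y₁, Y₂]) :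
    Linked ![Y₀, Y₁.transpose, Y₂.transpose] := by
  obtain ⟨α, inst, inst', f, hf, hs⟩ := h
  have h1 : pairing (fun g => f 0 g * (sg g * f 2 g)) (fun g => sg g * f 1 g) ≠ 0 := by
    rw [pairing_apply]
    convert hs using 1
    refine Finset.sum_congr rfl fun g _ => ?_
    rw [Fin.prod_univ_three]
    linear_combination (f 0 g * f 1 g * f 2 g) * sg_mul_self g
  obtain ⟨f₁, hf₁, h2⟩ := exists_ne_zero_of_mem_span (sg_mul_mem_span_fam (hf 1)) _ h1
  have h3 : pairing (fun g => f 0 g * f₁ g) (fun g => sg g * f 2 g) ≠ 0 := by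
    rw [pairing_apply] at h2 ⊢
    convert h2 using 1
    exact Finset.sum_congr rfl fun g _ => by ring
  obtain ⟨f₂, hf₂, h4⟩ := exists_ne_zero_of_mem_span (sg_mul_mem_span_fam (hf 2)) _ h3
  refine ⟨α, inst, inst', ![f 0, f₁, f₂], ?_, ?_⟩
  · intro i
    fin_cases i
    · exact hf 0
    · exact hf₁
    · exact hf₂
  · simpa [Fin.prod_univ_three, pairing_apply] using h4

lemma Linked.perm {Y : Fin 3 → YoungDiagram} (h : Linked Y) (s : Perm (Fin 3)) :
    Linked (Y ∘ s) := by
  obtain ⟨α, inst, inst', f, hf, hs⟩ := h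
  refine ⟨α, inst, inst', f ∘ s, fun i => hf (s i), ?_⟩
  convert hs using 1
  exact Finset.sum_congr rfl fun g _ => Equiv.prod_comp s fun i => f i g

section Polynomial

open MvPolynomial

variable {α β : Type} [Fintype α] [DecidableEq α] [Fintype β] [DecidableEq β]

/-- The sign of a column permutation, and zero otherwise. -/
noncomputable def colSign (c : α → ℕ) (a : Perm α) : ℂ := if c ∘ a = c then sg a else 0

/-- Generating polynomial of the products of the coefficients `ec`. -/
noncomputable def genPoly (r c : Fin 3 → α → ℕ) : MvPolynomial (Fin 3 → ℕ) ℂ :=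
  ∑ a : Fin 3 → Perm α, C (∏ i, colSign (c i) (a i)) * ∏ p, X (fun i => r i (a i p))

lemma exists_perm_of_sum_single_eq {ι : Type} {v w : α → ι}
    (h : ∑ p, Finsupp.single (v p) 1 = ∑ p, Finsupp.single (w p) (1 : ℕ)) :
    ∃ g : Perm α, v = w ∘ g := by
  classical
  have hc : ∀ x, Fintype.card {p // v p = x} = Fintype.card {p // w p = x} := by
    intro x
    have := congrArg (fun m => m x) h
    simp only [Finsupp.finsetSum_apply, Finsupp.single_apply] at this
    simpa [Fintype.card_subtype] using this
  refine ⟨(Equiv.sigmaFiberEquiv v).symm.trans ((Equiv.sigmaCongrRight fun x =>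
    Fintype.equivOfCardEq (hc x)).trans (Equiv.sigmaFiberEquiv w)), ?_⟩
  funext p
  simp only [Function.comp, Equiv.trans_apply]
  exact ((Fintype.equivOfCardEq (hc (v p))) ⟨p, rfl⟩).2.symm

lemma coeff_genPoly (r c w : Fin 3 → α → ℕ) :
    ∑ g : Perm α, ∏ i, ec (r i) (c i) (w i ∘ g) =
      (Finset.card {g : Perm α | ∀ i, w i ∘ g = w i} : ℂ) *
        (genPoly r c).coeff (∑ p, Finsupp.single (fun i => w i p) 1) := by
  classical
  have h1 : ∀ g : Perm α, ∏ i, ec (r i) (c i) (w i ∘ g) = ∑ a : Fin 3 → Perm α,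
      if (∀ i, w i ∘ g = r i ∘ a i) then ∏ i, colSign (c i) (a i) else 0 := by
    intro g
    unfold ec
    rw [Finset.prod_univ_sum, Fintype.piFinset_univ]
    refine Finset.sum_congr rfl fun a _ => ?_
    split_ifs with h
    · exact Finset.prod_congr rfl fun i _ => by simp [colSign, h i]
    · push Not at h
      obtain ⟨i, hi⟩ := h
      exact Finset.prod_eq_zero (Finset.mem_univ i) (by simp [hi])
  simp only [h1]
  rw [Finset.sum_comm, genPoly, coeff_sum, Finset.mul_sum]
  refine Finset.sum_congr rfl fun a _ => ?_
  have h2 : ∏ p, (X (fun i => r i (a i p)) : MvPolynomial (Fin 3 → ℕ) ℂ) =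
      monomial (∑ p, Finsupp.single (fun i => r i (a i p)) 1) 1 := by
    rw [monomial_sum_one]
    rfl
  rw [h2, coeff_C_mul, coeff_monomial, ← Finset.sum_filter, Finset.sum_const, nsmul_eq_mul]
  split_ifs with h
  · obtain ⟨g, hg⟩ := exists_perm_of_sum_single_eq h
    have hg' : ∀ i, r i ∘ a i = w i ∘ g := fun i => funext fun p => congrFun (congrFun hg p) i
    rw [mul_one]
    congr 2
    refine Finset.card_equiv (Equiv.mulRight g⁻¹) fun x => ?_
    simp only [Finset.mem_filter, Finset.mem_univ, true_and, Equiv.coe_mulRight, hg']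
    refine forall_congr' fun i => ?_
    rw [← (g⁻¹).surjective.injective_comp_right.eq_iff]
    simp only [Function.comp_assoc, ← Perm.coe_mul, mul_inv_cancel, Perm.coe_one,
      Function.comp_id]
  · rw [Finset.filter_eq_empty_iff.2]
    · simp
    intro g _ hg
    refine h ?_
    symm
    rw [← Equiv.sum_comp g]
    refine Finset.sum_congr rfl fun p _ => ?_
    congr 1
    funext i
    exact congrFun (hg i) p

lemma genPoly_sum (r c : Fin 3 → α → ℕ) (r' c' : Fin 3 → β → ℕ) :
    genPoly (fun i => Sum.elim (r i) (r' i))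
      (fun i => Sum.elim (fun p => 2 * c i p) (fun p => 2 * c' i p + 1)) =
    genPoly r c * genPoly r' c' := by
  unfold genPoly
  rw [Finset.sum_mul_sum, ← Finset.sum_product', Finset.univ_product_univ]
  symm
  refine Fintype.sum_of_injective
    (fun (x : (Fin 3 → Perm α) × (Fin 3 → Perm β)) i => Equiv.sumCongr (x.1 i) (x.2 i)) ?_ _ _ ?_ ?_
  · rintro ⟨a, b⟩ ⟨a', b'⟩ h
    ext i p
    · have := congrArg (fun s : Perm (α ⊕ β) => s (Sum.inl p)) (congrFun h i)
      simpa using this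
    · have := congrArg (fun s : Perm (α ⊕ β) => s (Sum.inr p)) (congrFun h i)
      simpa using this
  · intro s hs
    rw [Finset.prod_eq_zero_iff.2, C_0, zero_mul]
    by_contra! hne
    refine hs ?_
    have : ∀ i, ∃ x : Perm α × Perm β, Equiv.sumCongr x.1 x.2 = s i := by
      intro i
      have h1 := hne i (Finset.mem_univ i)
      have h2 : Sum.elim (fun p => 2 * c i p) (fun p => 2 * c' i p + 1) ∘ s i =
        Sum.elim (fun p => 2 * c i p) (fun p => 2 * c' i p + 1) := by
        by_contra hc
        exact h1 (if_neg hc)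
      have h3 : Set.MapsTo (s i) (Set.range Sum.inl) (Set.range Sum.inl) := by
        rintro _ ⟨p, rfl⟩
        have h4 := congrFun h2 (Sum.inl p)
        simp only [Function.comp, Sum.elim_inl] at h4
        rcases h5 : s i (Sum.inl p) with q | q
        · exact ⟨q, rfl⟩
        · rw [h5] at h4
          simp only [Sum.elim_inr] at h4
          lia
      obtain ⟨x, hx⟩ := Perm.mem_sumCongrHom_range_of_perm_mapsTo_inl h3
      exact ⟨x, hx⟩
    choose x hx using this
    exact ⟨(fun i => (x i).1, fun i => (x i).2), funext hx⟩
  · rintro ⟨a, b⟩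
    have h1 : ∀ i, colSign (Sum.elim (fun p => 2 * c i p) (fun p => 2 * c' i p + 1))
        (Equiv.sumCongr (a i) (b i)) = colSign (c i) (a i) * colSign (c' i) (b i) := by
      intro i
      have h2 : Sum.elim (fun p => 2 * c i p) (fun p => 2 * c' i p + 1) ∘
          Equiv.sumCongr (a i) (b i) = Sum.elim (fun p => 2 * c i p) (fun p => 2 * c' i p + 1) ↔
          c i ∘ a i = c i ∧ c' i ∘ b i = c' i := by
        simp [funext_iff, Sum.forall]
      have h3 : sg (Equiv.sumCongr (a i) (b i)) = sg (a i) * sg (b i) := by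
        simp [sg, Perm.sign_sumCongr]
      simp only [colSign, h2, h3]
      split_ifs <;> simp_all
    simp only [h1, Finset.prod_mul_distrib, C_mul, Fintype.prod_sum_type, Sum.elim_inl, Sum.elim_inr,
      Equiv.sumCongr_apply, Sum.map_inl, Sum.map_inr]
    ring

end Polynomial

section Shapes

namespace YoungDiagram

lemma ext_rowLen {Y Z : YoungDiagram} (h : ∀ i, Y.rowLen i = Z.rowLen i) : Y = Z := by
  ext ⟨i, j⟩
  rw [mem_cells, mem_cells, mem_iff_lt_rowLen, mem_iff_lt_rowLen, h]

lemma le_iff_rowLen {Y Z : YoungDiagram} : Y ≤ Z ↔ ∀ i, Y.rowLen i ≤ Z.rowLen i := by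
  constructor
  · intro h i
    by_contra! hlt
    exact lt_irrefl _ (mem_iff_lt_rowLen.1 (h (mem_iff_lt_rowLen.2 hlt)))
  · rintro h ⟨i, j⟩ hij
    exact mem_iff_lt_rowLen.2 ((mem_iff_lt_rowLen.1 hij).trans_le (h i))

lemma rowLen_eq_iff {Y : YoungDiagram} {i n : ℕ} : Y.rowLen i = n ↔ ∀ j, (i, j) ∈ Y ↔ j < n := by
  constructor
  · rintro rfl j
    exact mem_iff_lt_rowLen
  · intro h
    simp only [mem_iff_lt_rowLen] at h
    exact le_antisymm (not_lt.1 fun hl => lt_irrefl _ ((h n).1 hl))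
      (not_lt.1 fun hl => lt_irrefl _ ((h _).2 hl))

/-- The Young diagram with row lengths `f`. -/
def ofFun (f : ℕ → ℕ) (hf : Antitone f) (N : ℕ) : YoungDiagram where
  cells := ((Finset.range N) ×ˢ (Finset.range (f 0))).filter fun x => x.2 < f x.1
  isLowerSet := by
    rintro ⟨a, b⟩ ⟨a', b'⟩ ⟨h1, h2⟩ h
    simp only [Finset.coe_filter, Finset.mem_product, Finset.mem_range, Set.mem_ofPred_eq] at h h1 h2 ⊢
    have := hf h1
    lia

lemma rowLen_ofFun {f : ℕ → ℕ} (hf : Antitone f) {N : ℕ} (hN : f N = 0) (i : ℕ) :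
    (ofFun f hf N).rowLen i = f i := by
  rw [rowLen_eq_iff]
  intro j
  rw [← mem_cells]
  simp only [ofFun, Finset.mem_filter, Finset.mem_product, Finset.mem_range]
  refine ⟨fun h => h.2, fun h => ⟨⟨?_, h.trans_le (hf (Nat.zero_le i))⟩, h⟩⟩
  by_contra! hi
  have := hf hi
  lia

lemma rowLen_eq_zero (Y : YoungDiagram) {i : ℕ} (hi : Y.colLen 0 ≤ i) : Y.rowLen i = 0 := by
  by_contra h
  have : (i, 0) ∈ Y := mem_iff_lt_rowLen.2 (Nat.pos_of_ne_zero h)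
  rw [mem_iff_lt_colLen] at this
  lia

/-- The Young diagram whose row lengths are the sums of the row lengths of `Y` and `Z`. -/
def rowAdd (Y Z : YoungDiagram) : YoungDiagram :=
  ofFun (fun i => Y.rowLen i + Z.rowLen i)
    (fun i j hij => add_le_add (Y.rowLen_anti i j hij) (Z.rowLen_anti i j hij))
    (Y.colLen 0 + Z.colLen 0)

@[simp] lemma rowLen_rowAdd (Y Z : YoungDiagram) (i : ℕ) :
    (rowAdd Y Z).rowLen i = Y.rowLen i + Z.rowLen i :=
  rowLen_ofFun _ (by simp [rowLen_eq_zero]) i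

end YoungDiagram

end Shapes

section Sorting

open Finset

variable {α : Type} [Fintype α] [DecidableEq α]

lemma IsTab.rowLen_eq {Y : YoungDiagram} {r c : α → ℕ} (h : IsTab Y r c) (k : ℕ) :
    Y.rowLen k = #{p | r p = k} := by
  symm
  rw [← card_range (Y.rowLen k)]
  refine card_nbij c ?_ ?_ ?_
  · intro p hp
    simp only [mem_filter, mem_univ, true_and, mem_coe, mem_range] at hp ⊢
    exact YoungDiagram.mem_iff_lt_rowLen.1 (hp ▸ h.mem p)
  · intro p hp q hq hpq
    simp only [coe_filter, mem_univ, true_and, Set.mem_ofPred_eq] at hp hq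
    exact h.inj p q (hp.trans hq.symm) hpq
  · intro i hi
    simp only [coe_range, Set.mem_Iio] at hi
    obtain ⟨p, h1, h2⟩ := h.surj k i (YoungDiagram.mem_iff_lt_rowLen.2 hi)
    exact ⟨p, by simp [h1], h2⟩

lemma IsTab.card_eq {Y : YoungDiagram} {r c : α → ℕ} (h : IsTab Y r c) :
    Fintype.card α = Y.card := by
  rw [← card_univ]
  refine card_nbij (fun p => (r p, c p)) ?_ ?_ ?_
  · intro p _
    exact h.mem p
  · intro p _ q _ hpq
    simp only [Prod.mk.injEq] at hpq
    exact h.inj p q hpq.1 hpq.2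
  · rintro ⟨i, j⟩ hij
    obtain ⟨p, h1, h2⟩ := h.surj i j hij
    exact ⟨p, by simp, by simp [h1, h2]⟩

/-- Relabelling the columns by decreasing length turns a filling with left-justified columns into a
tableau. -/
lemma exists_isTab {Y : YoungDiagram} {r c : α → ℕ} (hinj : ∀ p q, r p = r q → c p = c q → p = q)
    (hjust : ∀ p, ∀ i < r p, ∃ q, c q = c p ∧ r q = i) (hY : ∀ k, Y.rowLen k = #{p | r p = k}) :
    ∃ c' : α → ℕ, (∀ p q, c p = c q ↔ c' p = c' q) ∧ IsTab Y r c' := by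
  set s : ℕ → ℕ := fun v => #{p | c p = v}
  have hs1 : ∀ p, r p < s (c p) := by
    intro p
    have : #(range (r p + 1)) ≤ #(({q | c q = c p} : Finset α).image r) := by
      refine card_le_card fun i hi => ?_
      simp only [mem_range, mem_image, mem_filter, mem_univ, true_and] at hi ⊢
      rcases Nat.lt_succ_iff_lt_or_eq.1 hi with h | h
      · exact hjust p i h
      · exact ⟨p, rfl, h.symm⟩
    rw [card_range] at this
    exact this.trans card_image_le
  have hs2 : ∀ v k, k < s v → ∃ q, c q = v ∧ r q = k := by
    intro v k hk
    by_contra! hne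
    have h1 : #({q | c q = v} : Finset α) ≤ #(range k) := by
      refine card_le_card_of_injOn r (fun p hp => ?_) fun p hp q hq hpq => ?_
      · simp only [coe_filter, mem_univ, true_and, Set.mem_ofPred_eq] at hp
        simp only [coe_range, Set.mem_Iio]
        rcases lt_trichotomy (r p) k with h | h | h
        · exact h
        · exact absurd h (hne p hp)
        · obtain ⟨q, h1, h2⟩ := hjust p k h
          exact absurd h2 (hne q (h1.trans hp))
      · simp only [coe_filter, mem_univ, true_and, Set.mem_ofPred_eq] at hp hq
        exact hinj p q hpq (hp.trans hq.symm)
    rw [card_range] at h1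
    lia
  let lt : ℕ → ℕ → Prop := fun u v => s v < s u ∨ (s u = s v ∧ u < v)
  have hlt : DecidableRel lt := fun u v => inferInstanceAs (Decidable (_ ∨ _))
  have lt_trans' : ∀ {u v w}, lt u v → lt v w → lt u w := by
    intro u v w h1 h2
    simp only [lt] at h1 h2 ⊢
    lia
  let rk : ℕ → ℕ := fun v => #{u ∈ univ.image c | lt u v}
  have rk_lt : ∀ {u v}, u ∈ univ.image c → lt u v → rk u < rk v := by
    intro u v hu huv
    refine card_lt_card ⟨fun w hw => ?_, fun hsub => ?_⟩
    · simp only [mem_filter] at hw ⊢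
      exact ⟨hw.1, lt_trans' hw.2 huv⟩
    · have := hsub (mem_filter.2 ⟨hu, huv⟩)
      simp [lt] at this
  have rk_inj : ∀ p q, c p = c q ↔ rk (c p) = rk (c q) := by
    intro p q
    refine ⟨fun h => by rw [h], fun h => ?_⟩
    by_contra hne
    have : lt (c p) (c q) ∨ lt (c q) (c p) := by simp only [lt]; lia
    rcases this with h' | h'
    · exact absurd h (rk_lt (by simp) h').ne
    · exact absurd h (rk_lt (by simp) h').ne'
  have rk_bd : ∀ p, rk (c p) < #({q | r q = r p} : Finset α) := by
    intro p
    refine lt_of_lt_of_le (card_lt_card (t := ({q | r q = r p} : Finset α).image c) ⟨?_, ?_⟩)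
      card_image_le
    · intro u hu
      simp only [mem_filter, mem_image, mem_univ, true_and, lt] at hu ⊢
      have := hs1 p
      obtain ⟨q, h1, h2⟩ := hs2 u (r p) (by lia)
      exact ⟨q, h2, h1⟩
    · intro hsub
      have := @hsub (c p) (mem_image.2 ⟨p, by simp, rfl⟩)
      simp [lt] at this
  refine ⟨fun p => rk (c p), rk_inj, ⟨?_, ?_, ?_⟩⟩
  · intro p q h1 h2
    exact hinj p q h1 ((rk_inj p q).2 h2)
  · intro p
    rw [YoungDiagram.mem_iff_lt_rowLen, hY]
    exact rk_bd p
  · intro i j hij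
    rw [YoungDiagram.mem_iff_lt_rowLen, hY] at hij
    have h1 : ({q | r q = i} : Finset α).image (fun p => rk (c p)) =
        range #({q | r q = i} : Finset α) := by
      refine eq_of_subset_of_card_le (fun x hx => ?_) ?_
      · simp only [mem_image, mem_filter, mem_univ, true_and] at hx
        obtain ⟨p, rfl, rfl⟩ := hx
        exact mem_range.2 (rk_bd p)
      · rw [card_range, card_image_of_injOn]
        intro p hp q hq hpq
        simp only [coe_filter, mem_univ, true_and, Set.mem_ofPred_eq] at hp hq
        exact hinj p q (hp.trans hq.symm) ((rk_inj p q).2 hpq)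
    have h2 : j ∈ ({q | r q = i} : Finset α).image (fun p => rk (c p)) := by
      rw [h1]
      exact mem_range.2 hij
    simp only [mem_image, mem_filter, mem_univ, true_and] at h2
    exact h2

lemma linked_of_genPoly_ne_zero {Y : Fin 3 → YoungDiagram} {r c c' : Fin 3 → α → ℕ}
    (h : ∀ i, IsTab (Y i) (r i) (c' i)) (hc : ∀ i p q, c i p = c i q ↔ c' i p = c' i q)
    (hne : genPoly r c ≠ 0) : Linked Y := by
  obtain ⟨m, hm⟩ := MvPolynomial.ne_zero_iff.1 hne
  have hm' := hm
  rw [genPoly, MvPolynomial.coeff_sum] at hm'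
  obtain ⟨a, -, ha⟩ := Finset.exists_ne_zero_of_sum_ne_zero hm'
  have h2 : ∏ p, (MvPolynomial.X (fun i => r i (a i p)) : MvPolynomial (Fin 3 → ℕ) ℂ) =
      MvPolynomial.monomial (∑ p, Finsupp.single (fun i => r i (a i p)) 1) 1 := by
    rw [MvPolynomial.monomial_sum_one]
    rfl
  rw [h2, MvPolynomial.coeff_C_mul, MvPolynomial.coeff_monomial] at ha
  have h3 : ∑ p, Finsupp.single (fun i => r i (a i p)) 1 = m := by
    by_contra h3
    simp [h3] at ha
  refine ⟨α, inferInstance, inferInstance, fun i g => E (r i) (c' i) (a i * g),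
    fun i => ⟨_, _, h i, a i, rfl⟩, ?_⟩
  have h4 := coeff_genPoly r c (fun i => r i ∘ a i)
  simp only [ec_congr_col (hc _)] at h4
  have h5 : ∑ g : Perm α, ∏ i, E (r i) (c' i) (a i * g) =
      ∑ g : Perm α, ∏ i, ec (r i) (c' i) ((r i ∘ a i) ∘ g) := rfl
  rw [h5, h4]
  refine mul_ne_zero ?_ ?_
  · rw [Nat.cast_ne_zero]
    exact card_ne_zero.2 ⟨1, by simp⟩
  · simp only [Function.comp]
    rwa [h3]

lemma Linked.exists_genPoly_ne_zero {Y : Fin 3 → YoungDiagram} (h : Linked Y) :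
    ∃ (α : Type) (_ : Fintype α) (_ : DecidableEq α) (r c : Fin 3 → α → ℕ),
      (∀ i, IsTab (Y i) (r i) (c i)) ∧ genPoly r c ≠ 0 := by
  obtain ⟨α, inst, inst', f, hf, hs⟩ := h
  choose r c h x hx using hf
  refine ⟨α, inst, inst', r, c, h, fun h0 => hs ?_⟩
  have h1 := coeff_genPoly r c (fun i => r i ∘ x i)
  rw [h0, MvPolynomial.coeff_zero, mul_zero] at h1
  rw [← h1]
  refine Finset.sum_congr rfl fun g _ => Finset.prod_congr rfl fun i _ => ?_
  rw [hx]
  rfl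

theorem Linked.rowAdd {Y Z : Fin 3 → YoungDiagram} (hY : Linked Y) (hZ : Linked Z) :
    Linked fun i => (Y i).rowAdd (Z i) := by
  obtain ⟨α, _, _, r, c, h, hne⟩ := hY.exists_genPoly_ne_zero
  obtain ⟨β, _, _, r', c', h', hne'⟩ := hZ.exists_genPoly_ne_zero
  have key : ∀ i, ∃ d : α ⊕ β → ℕ, (∀ p q,
      Sum.elim (fun p => 2 * c i p) (fun p => 2 * c' i p + 1) p =
        Sum.elim (fun p => 2 * c i p) (fun p => 2 * c' i p + 1) q ↔ d p = d q) ∧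
      IsTab ((Y i).rowAdd (Z i)) (Sum.elim (r i) (r' i)) d := by
    intro i
    refine exists_isTab ?_ ?_ ?_
    · rintro (p | p) (q | q) h1 h2
      · simp only [Sum.elim_inl] at h1 h2
        rw [(h i).inj p q h1 (by lia)]
      · simp only [Sum.elim_inl, Sum.elim_inr] at h1 h2
        lia
      · simp only [Sum.elim_inl, Sum.elim_inr] at h1 h2
        lia
      · simp only [Sum.elim_inr] at h1 h2
        rw [(h' i).inj p q h1 (by lia)]
    · rintro (p | p) j hj
      · obtain ⟨q, h1, h2⟩ := (h i).surj j (c i p)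
          (YoungDiagram.up_left_mem _ (le_of_lt hj) le_rfl ((h i).mem p))
        exact ⟨Sum.inl q, by simp [h2], h1⟩
      · obtain ⟨q, h1, h2⟩ := (h' i).surj j (c' i p)
          (YoungDiagram.up_left_mem _ (le_of_lt hj) le_rfl ((h' i).mem p))
        exact ⟨Sum.inr q, by simp [h2], h1⟩
    · intro k
      rw [YoungDiagram.rowLen_rowAdd, (h i).rowLen_eq, (h' i).rowLen_eq]
      simp only [card_filter, Fintype.sum_sum_type, Sum.elim_inl, Sum.elim_inr]
      rfl
  choose d hd hd' using key
  exact linked_of_genPoly_ne_zero hd' hd (by rw [genPoly_sum]; exact mul_ne_zero hne hne')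

end Sorting

namespace YoungDiagram

open Finset

/-- The number of cells in the first `j` columns. -/
def colSum (Y : YoungDiagram) (j : ℕ) : ℕ := ∑ v ∈ range j, Y.colLen v

lemma colSum_succ (Y : YoungDiagram) (j : ℕ) : Y.colSum (j + 1) = Y.colSum j + Y.colLen j :=
  sum_range_succ _ _

lemma colSum_mono (Y : YoungDiagram) : Monotone Y.colSum :=
  fun _ _ h => sum_le_sum_of_subset (range_mono h)

lemma colSum_eq_card_filter (Y : YoungDiagram) (j : ℕ) :
    Y.colSum j = #{x ∈ Y.cells | x.2 < j} := by
  rw [card_eq_sum_card_fiberwise (f := Prod.snd) (t := range j) (fun x hx => by simp_all), colSum]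
  refine sum_congr rfl fun v hv => ?_
  rw [colLen_eq_card, col, filter_filter]
  congr 1
  ext x
  simp only [mem_filter, mem_range] at hv ⊢
  constructor
  · rintro ⟨h1, h2⟩
    exact ⟨h1, h2 ▸ hv, h2⟩
  · rintro ⟨h1, h2, h3⟩
    exact ⟨h1, h3⟩

lemma colSum_le_card (Y : YoungDiagram) (j : ℕ) : Y.colSum j ≤ Y.card := by
  rw [colSum_eq_card_filter]
  exact card_filter_le _ _

lemma colSum_eq_card (Y : YoungDiagram) {j : ℕ} (hj : Y.rowLen 0 ≤ j) : Y.colSum j = Y.card := by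
  rw [colSum_eq_card_filter, filter_true_of_mem]
  rintro ⟨a, b⟩ hx
  have := mem_iff_lt_rowLen.1 ((mem_cells _).1 hx)
  have := Y.rowLen_anti 0 a (Nat.zero_le _)
  simp only
  lia

lemma card_transpose (Y : YoungDiagram) : Y.transpose.card = Y.card :=
  Finset.card_map _

lemma colLen_eq_iff {Y : YoungDiagram} {j n : ℕ} : Y.colLen j = n ↔ ∀ i, (i, j) ∈ Y ↔ i < n := by
  rw [← rowLen_transpose, rowLen_eq_iff]
  simp [mem_transpose]

end YoungDiagram

section Blocks

variable {α : Type} [Fintype α] [DecidableEq α]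

/-- Tableaux whose columns are consecutive blocks with respect to an enumeration `key`. -/
lemma exists_block_tab (Y : YoungDiagram) (key : α → ℕ) (hinj : Function.Injective key)
    (hlt : ∀ p, key p < Y.card) (hcard : Fintype.card α = Y.card) :
    ∃ r c : α → ℕ, IsTab Y r c ∧ ∀ p, key p = Y.colSum (c p) + r p := by
  have hkey : ∀ x ∈ Y.cells, Y.colSum x.2 + x.1 < Y.colSum (x.2 + 1) := by
    rintro ⟨i, j⟩ hx
    rw [Y.colSum_succ]
    have := YoungDiagram.mem_iff_lt_colLen.1 ((YoungDiagram.mem_cells _).1 hx)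
    simpa using this
  have hI : Set.InjOn (fun x : ℕ × ℕ => Y.colSum x.2 + x.1) Y.cells := by
    rintro ⟨i, j⟩ hx ⟨i', j'⟩ hx' h
    have h1 := hkey _ hx
    have h2 := hkey _ hx'
    simp only at h h1 h2
    rcases lt_trichotomy j j' with hj | hj | hj
    · have := Y.colSum_mono (show j + 1 ≤ j' from hj)
      lia
    · subst hj
      simp only [Prod.mk.injEq, and_true]
      lia
    · have := Y.colSum_mono (show j' + 1 ≤ j from hj)
      lia
  have him : Y.cells.image (fun x : ℕ × ℕ => Y.colSum x.2 + x.1) = Finset.range Y.card := by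
    refine Finset.eq_of_subset_of_card_le (fun k hk => ?_) ?_
    · obtain ⟨x, hx, rfl⟩ := Finset.mem_image.1 hk
      exact Finset.mem_range.2 ((hkey x hx).trans_le (Y.colSum_le_card _))
    · rw [Finset.card_range, Finset.card_image_of_injOn hI]
  have hex : ∀ p, ∃ x ∈ Y.cells, Y.colSum x.2 + x.1 = key p := fun p => by
    have := Finset.mem_range.2 (hlt p)
    rw [← him] at this
    simpa only [Finset.mem_image] using this
  choose x hx hxk using hex
  have hxi : Function.Injective x := fun p q h => hinj (by rw [← hxk, ← hxk, h])
  refine ⟨fun p => (x p).1, fun p => (x p).2, ⟨fun p q h1 h2 => hxi (Prod.ext h1 h2),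
    fun p => hx p, fun i j hij => ?_⟩, fun p => (hxk p).symm⟩
  have : Finset.univ.image x = Y.cells := by
    refine Finset.eq_of_subset_of_card_le (fun k hk => ?_) ?_
    · obtain ⟨p, -, rfl⟩ := Finset.mem_image.1 hk
      exact hx p
    · rw [Finset.card_image_of_injective _ hxi, Finset.card_univ, hcard]
  have h2 : (i, j) ∈ Finset.univ.image x := by rw [this]; exact hij
  obtain ⟨p, -, hp⟩ := Finset.mem_image.1 h2
  exact ⟨p, by simp [hp], by simp [hp]⟩

end Blocks

section Transversal

open Finset

variable {α : Type} [Fintype α] [DecidableEq α]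

lemma linked_of_sum_ec_ne_zero {Y : Fin 3 → YoungDiagram} {r c : Fin 3 → α → ℕ}
    (h : ∀ i, IsTab (Y i) (r i) (c i)) (w : Fin 3 → α → ℕ)
    (hne : ∑ g : Perm α, ∏ i, ec (r i) (c i) (w i ∘ g) ≠ 0) : Linked Y := by
  refine linked_of_genPoly_ne_zero h (fun _ _ _ => Iff.rfl) fun h0 => hne ?_
  rw [coeff_genPoly, h0, MvPolynomial.coeff_zero, mul_zero]

/-- A rearrangement of `w` within the columns of `Y` is column equivalent to the tableau. -/
lemma IsTab.exists_perm_of_inj {Y : YoungDiagram} {r c : α → ℕ} (h : IsTab Y r c) {w : α → ℕ}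
    (hw : ∀ p q, c p = c q → w p = w q → p = q) (hm : ∀ p, w p < Y.colLen (c p)) :
    ∃ a : Perm α, c ∘ a = c ∧ w = r ∘ a := by
  choose f hf1 hf2 using fun p => h.surj _ _ (YoungDiagram.mem_iff_lt_colLen.2 (hm p))
  have hf : Function.Injective f := fun p q hpq =>
    hw p q (by rw [← hf2 p, ← hf2 q, hpq]) (by rw [← hf1 p, ← hf1 q, hpq])
  exact ⟨Equiv.ofBijective f (Finite.injective_iff_bijective.1 hf), funext hf2,
    (funext fun p => (hf1 p).symm)⟩

lemma IsTab.ec_eq {Y : YoungDiagram} {r c : α → ℕ} (h : IsTab Y r c) {a : Perm α}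
    (ha : c ∘ a = c) : ec r c (r ∘ a) = sg a := by
  rw [ec_comp_right r c r ha]
  have := h.E_one
  unfold E at this
  rw [Perm.coe_one, Function.comp_id] at this
  rw [this, mul_one]

lemma comp_inv_eq {c : α → ℕ} {a : Perm α} (ha : c ∘ a = c) : c ∘ (a⁻¹ : Perm α) = c := by
  rw [← a.surjective.injective_comp_right.eq_iff, Function.comp_assoc, ← Perm.coe_mul]
  simp [ha]

/-- Two tableaux, of shapes `X` and `Y`, such that the columns of `X` meet the columns of `Y` in at
most one point. If the columns of `Y` have distinct lengths, then `X` occurs in the square of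
`Y`. -/
theorem linked_of_transversal {X Y : YoungDiagram} {r₁ c₁ r₂ c₂ : α → ℕ} (h₁ : IsTab X r₁ c₁)
    (h₂ : IsTab Y r₂ c₂) (ht : ∀ p q, c₁ p = c₁ q → c₂ p = c₂ q → p = q)
    (hd : ∀ p q, Y.colLen (c₂ p) = Y.colLen (c₂ q) → c₂ p = c₂ q) : Linked ![X, Y, Y] := by
  have hr₂ : ∀ p, r₂ p < Y.colLen (c₂ p) := fun p => YoungDiagram.mem_iff_lt_colLen.1 (h₂.mem p)
  -- the reversed columns of `Y`
  set w₃ : α → ℕ := fun p => Y.colLen (c₂ p) - 1 - r₂ p with hw₃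
  obtain ⟨b, hb, hwb⟩ : ∃ b : Perm α, c₂ ∘ b = c₂ ∧ w₃ = r₂ ∘ b := by
    refine h₂.exists_perm_of_inj (fun p q hc hw => ?_) (fun p => ?_)
    · have h1 := hr₂ p
      have h2 := hr₂ q
      simp only [hw₃, hc] at hw h1
      exact h₂.inj p q (by lia) hc
    · have h1 := hr₂ p
      simp only [hw₃]
      lia
  set u : α → ℤ := fun p => (Y.colLen (c₂ p) : ℤ) - 1 with hu
  have hu3 : ∀ p, u p = r₂ p + w₃ p := fun p => by
    have := hr₂ p
    simp only [hu, hw₃]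
    lia
  have hua : ∀ a : Perm α, c₂ ∘ a = c₂ → ∑ p, u p * r₂ (a p) = ∑ p, u p * r₂ p := by
    intro a ha
    rw [← Equiv.sum_comp a fun p => u p * (r₂ p : ℤ)]
    refine sum_congr rfl fun p _ => ?_
    have : c₂ (a p) = c₂ p := congrFun ha p
    simp only [hu, this]
  have hcol : ∀ g : Perm α, ec r₂ c₂ (r₂ ∘ g) ≠ 0 → ec r₂ c₂ (w₃ ∘ g) ≠ 0 → c₂ ∘ g = c₂ := by
    intro g hg1 hg2
    obtain ⟨a, ha, hga⟩ := exists_of_ec_ne_zero hg1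
    obtain ⟨a', ha', hga'⟩ := exists_of_ec_ne_zero hg2
    have h1 : ∑ p, u p * u p = 2 * ∑ p, u p * r₂ p := by
      calc ∑ p, u p * u p = ∑ p, u p * r₂ p + ∑ p, u p * r₂ (b p) := by
            rw [← sum_add_distrib]
            refine sum_congr rfl fun p _ => ?_
            have : w₃ p = r₂ (b p) := congrFun hwb p
            rw [← this]
            nth_rewrite 2 [hu3]
            ring
        _ = _ := by rw [hua b hb]; ring
    have h2 : ∑ p, u p * u (g p) = 2 * ∑ p, u p * r₂ p := by
      calc ∑ p, u p * u (g p) = ∑ p, u p * r₂ (a p) + ∑ p, u p * r₂ (a' p) := by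
            rw [← sum_add_distrib]
            refine sum_congr rfl fun p _ => ?_
            have e1 : r₂ (g p) = r₂ (a p) := congrFun hga p
            have e2 : w₃ (g p) = r₂ (a' p) := congrFun hga' p
            rw [hu3 (g p), e1, e2]
            ring
        _ = _ := by rw [hua a ha, hua a' ha']; ring
    have h3 : ∑ p, u (g p) * u (g p) = ∑ p, u p * u p := Equiv.sum_comp g fun p => u p * u p
    have h4 : ∑ p, (u p - u (g p)) ^ 2 = 0 := by
      have : ∀ p, (u p - u (g p)) ^ 2 = u p * u p + u (g p) * u (g p) - 2 * (u p * u (g p)) :=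
        fun p => by ring
      simp only [this, sum_sub_distrib, sum_add_distrib, ← mul_sum]
      rw [h3, h2, h1]
      ring
    rw [sum_eq_zero_iff_of_nonneg (fun _ _ => sq_nonneg _)] at h4
    funext p
    refine hd _ _ ?_
    have h5 := h4 p (mem_univ p)
    have h6 : u p = u (g p) := by
      have := pow_eq_zero_iff (two_ne_zero) |>.1 h5
      lia
    simp only [hu] at h6
    lia
  -- the rank of the second label in the columns of `X`
  set w₁ : α → ℕ := fun p => #{q | c₁ q = c₁ p ∧ c₂ q < c₂ p} with hw₁
  have w_lt : ∀ p q, c₁ p = c₁ q → c₂ p < c₂ q → w₁ p < w₁ q := by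
    intro p q h1 h2
    refine card_lt_card ⟨fun x hx => ?_, fun hsub => ?_⟩
    · simp only [mem_filter, mem_univ, true_and] at hx ⊢
      exact ⟨hx.1.trans h1, hx.2.trans h2⟩
    · have := @hsub p (by simp [h1, h2])
      simp at this
  have w_iff : ∀ p q, c₁ p = c₁ q → (w₁ p < w₁ q ↔ c₂ p < c₂ q) := by
    intro p q h1
    refine ⟨fun h => ?_, w_lt p q h1⟩
    rcases lt_trichotomy (c₂ p) (c₂ q) with h' | h' | h'
    · exact h'
    · rw [ht p q h1 h'] at h
      lia
    · have := w_lt q p h1.symm h'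
      lia
  have w_rank : ∀ p, w₁ p = #{q | c₁ q = c₁ p ∧ w₁ q < w₁ p} := by
    intro p
    nth_rewrite 1 [hw₁]
    simp only
    congr 1
    ext q
    simp only [mem_filter, mem_univ, true_and]
    exact and_congr_right fun h => (w_iff q p h).symm
  obtain ⟨a₀, ha₀, hwa₀⟩ : ∃ a : Perm α, c₁ ∘ a = c₁ ∧ w₁ = r₁ ∘ a := by
    refine h₁.exists_perm_of_inj (fun p q hc hw => ?_) (fun p => ?_)
    · refine ht p q hc ?_
      have e1 := w_iff p q hc
      have e2 := w_iff q p hc.symm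
      lia
    · have e1 := h₁.card_col (X.colLen (c₁ p)) (c₁ p)
      rw [min_self] at e1
      rw [← e1]
      refine card_lt_card ⟨fun x hx => ?_, fun hsub => ?_⟩
      · simp only [mem_filter, mem_univ, true_and] at hx ⊢
        exact ⟨hx.1, hx.1 ▸ YoungDiagram.mem_iff_lt_colLen.1 (h₁.mem x)⟩
      · have := @hsub p (by simpa using YoungDiagram.mem_iff_lt_colLen.1 (h₁.mem p))
        simp at this
  have hrigid : ∀ g : Perm α, c₂ ∘ g = c₂ → ec r₁ c₁ (w₁ ∘ g) ≠ 0 → w₁ ∘ g = w₁ := by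
    intro g hg hne
    obtain ⟨a₁, ha₁, hga₁⟩ := exists_of_ec_ne_zero hne
    set σ : Perm α := a₀⁻¹ * a₁ with hσ
    have hσc : ∀ p, c₁ (σ p) = c₁ p := fun p => by
      have e1 := congrFun (comp_inv_eq ha₀) (a₁ p)
      have e2 := congrFun ha₁ p
      simp only [Function.comp] at e1 e2
      rw [hσ, Perm.mul_apply, e1, e2]
    have hσw : ∀ p, w₁ (g p) = w₁ (σ p) := fun p => by
      have e1 := congrFun hga₁ p
      simp only [Function.comp] at e1
      rw [e1, hσ, Perm.mul_apply, hwa₀]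
      simp
    set M : ℤ := ∑ p, (c₂ p : ℤ) + 1
    set H : ℤ := ∑ p, (w₁ p : ℤ) + 1
    have hMb : ∀ p, (c₂ p : ℤ) < M := fun p => by
      have := single_le_sum (f := fun p => (c₂ p : ℤ)) (fun _ _ => by positivity) (mem_univ p)
      lia
    have hHb : ∀ p, (w₁ p : ℤ) < H := fun p => by
      have := single_le_sum (f := fun p => (w₁ p : ℤ)) (fun _ _ => Int.natCast_nonneg _) (mem_univ p)
      lia
    set F : α → ℤ := fun p => M * c₁ p + c₂ p with hF
    set W : α → ℤ := fun p => H * c₁ p + w₁ p with hW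
    have F_lt : ∀ p q, c₁ p < c₁ q → F p < F q := by
      intro p q hpq
      simp only [hF]
      have e1 : (c₁ p : ℤ) + 1 ≤ c₁ q := by exact_mod_cast hpq
      have e2 := hMb p
      have e3 : M * (c₁ p + 1) ≤ M * c₁ q := mul_le_mul_of_nonneg_left e1 (by lia)
      have e4 : (0 : ℤ) ≤ c₂ q := by positivity
      linarith
    have W_lt : ∀ p q, c₁ p < c₁ q → W p < W q := by
      intro p q hpq
      simp only [hW]
      have e1 : (c₁ p : ℤ) + 1 ≤ c₁ q := by exact_mod_cast hpq
      have e2 := hHb p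
      have e3 : H * (c₁ p + 1) ≤ H * c₁ q := mul_le_mul_of_nonneg_left e1 (by lia)
      have e4 : (0 : ℤ) ≤ w₁ q := Int.natCast_nonneg _
      linarith
    have hmono : Monovary F W := by
      intro p q hpq
      rcases lt_trichotomy (c₁ p) (c₁ q) with h | h | h
      · exact (F_lt p q h).le
      · have e1 : w₁ p < w₁ q := by
          simp only [hW, h] at hpq
          lia
        have e2 := (w_iff p q h).1 e1
        simp only [hF, h]
        lia
      · exact absurd hpq (W_lt q p h).not_gt
    have hsum : ∑ p, F p * W (σ p) = ∑ p, F p * W p := by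
      have e1 : ∑ p, (c₁ p : ℤ) * w₁ (σ p) = ∑ p, (c₁ p : ℤ) * w₁ p := by
        rw [← Equiv.sum_comp σ fun p => (c₁ p : ℤ) * w₁ p]
        simp only [hσc]
      have e2 : ∑ p, (c₂ p : ℤ) * w₁ (σ p) = ∑ p, (c₂ p : ℤ) * w₁ p := by
        rw [← Equiv.sum_comp g fun p => (c₂ p : ℤ) * w₁ p]
        refine sum_congr rfl fun p _ => ?_
        have : c₂ (g p) = c₂ p := congrFun hg p
        rw [← hσw, this]
      have e3 : ∀ p, F p * W (σ p) = F p * (H * c₁ p) + M * (c₁ p * w₁ (σ p)) +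
          c₂ p * w₁ (σ p) := fun p => by simp only [hF, hW, hσc]; ring
      have e4 : ∀ p, F p * W p = F p * (H * c₁ p) + M * (c₁ p * w₁ p) + c₂ p * w₁ p :=
        fun p => by simp only [hF, hW]; ring
      simp only [e3, e4, sum_add_distrib, ← mul_sum]
      rw [e1, e2]
    rw [hmono.sum_mul_comp_perm_eq_sum_mul_iff] at hsum
    have key : ∀ p q, c₁ p = c₁ q → (w₁ (σ p) < w₁ (σ q) ↔ w₁ p < w₁ q) := by
      intro p q hpq
      have aux : ∀ p q, c₁ p = c₁ q → w₁ (σ p) < w₁ (σ q) → w₁ p < w₁ q := by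
        intro p q hpq hlt
        have e1 : W (σ p) < W (σ q) := by
          simp only [hW, hσc, hpq]
          lia
        have e2 := hsum e1
        simp only [hF, hpq] at e2
        rw [w_iff p q hpq]
        rcases lt_or_eq_of_le (show c₂ p ≤ c₂ q by lia) with h | h
        · exact h
        · rw [ht p q hpq h] at hlt
          lia
      refine ⟨aux p q hpq, fun hlt => ?_⟩
      rcases lt_trichotomy (w₁ (σ p)) (w₁ (σ q)) with h | h | h
      · exact h
      · have e1 := w_iff (σ p) (σ q) (by rw [hσc, hσc, hpq])
        have e2 := w_iff (σ q) (σ p) (by rw [hσc, hσc, hpq])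
        have e3 : σ p = σ q := ht _ _ (by rw [hσc, hσc, hpq]) (by lia)
        rw [σ.injective e3] at hlt
        lia
      · have := aux q p hpq.symm h
        lia
    funext p
    simp only [Function.comp]
    rw [hσw, w_rank (σ p), w_rank p]
    symm
    refine card_equiv σ fun q => ?_
    simp only [mem_filter, mem_univ, true_and, hσc]
    exact and_congr_right fun h => (key q p h).symm
  refine linked_of_sum_ec_ne_zero (r := ![r₁, r₂, r₂]) (c := ![c₁, c₂, c₂]) ?_ ![w₁, r₂, w₃] ?_
  · intro i
    fin_cases i
    · exact h₁
    · exact h₂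
    · exact h₂
  have hterm : ∀ g : Perm α, ∏ i, ec (![r₁, r₂, r₂] i) (![c₁, c₂, c₂] i) (![w₁, r₂, w₃] i ∘ g) =
      if c₂ ∘ g = c₂ ∧ w₁ ∘ g = w₁ then sg a₀ * sg b else 0 := by
    intro g
    simp only [Fin.prod_univ_three, Matrix.cons_val]
    split_ifs with hg
    · rw [hg.2, h₂.ec_eq hg.1, ec_comp_right r₂ c₂ w₃ hg.1, hwb, h₂.ec_eq hb, hwa₀, h₁.ec_eq ha₀]
      linear_combination sg a₀ * sg b * sg_mul_self g
    · by_contra hne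
      have e1 : ec r₁ c₁ (w₁ ∘ g) ≠ 0 := fun h => hne (by rw [h]; ring)
      have e2 : ec r₂ c₂ (r₂ ∘ g) ≠ 0 := fun h => hne (by rw [h]; ring)
      have e3 : ec r₂ c₂ (w₃ ∘ g) ≠ 0 := fun h => hne (by rw [h]; ring)
      exact hg ⟨hcol g e2 e3, hrigid g (hcol g e2 e3) e1⟩
  simp only [hterm]
  rw [← sum_filter, sum_const, nsmul_eq_mul]
  refine mul_ne_zero ?_ (mul_ne_zero (sg_ne_zero _) (sg_ne_zero _))
  rw [Nat.cast_ne_zero]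
  exact card_ne_zero.2 ⟨1, by simp⟩

end Transversal

section Trapezoid

open YoungDiagram

/-- The Young diagram with `2 * h` columns, of lengths `p + 2 * h, …, p + 1`. -/
def trap (p h : ℕ) : YoungDiagram :=
  ofFun (fun i => min (2 * h) (p + 2 * h - i)) (fun i j hij => by simp only; lia) (p + 2 * h)

lemma rowLen_trap (p h i : ℕ) : (trap p h).rowLen i = min (2 * h) (p + 2 * h - i) :=
  rowLen_ofFun _ (by simp) i

lemma colLen_trap (p h j : ℕ) : (trap p h).colLen j = if j < 2 * h then p + 2 * h - j else 0 := by
  rw [colLen_eq_iff]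
  intro i
  rw [mem_iff_lt_rowLen, rowLen_trap]
  split_ifs <;> lia

lemma two_mul_sum_range_sub {A m : ℕ} (hm : m ≤ A) :
    2 * ∑ j ∈ Finset.range m, (A - j) + m * m = 2 * A * m + m := by
  induction m with
  | zero => simp
  | succ m ih =>
    have := ih (by lia)
    rw [Finset.sum_range_succ]
    obtain ⟨B, rfl⟩ := Nat.exists_eq_add_of_le (show m ≤ A by lia)
    rw [Nat.add_sub_cancel_left]
    nlinarith

lemma card_trap (p h : ℕ) : (trap p h).card = h * (2 * p + 2 * h + 1) := by
  rw [← colSum_eq_card (j := 2 * h) _ (by rw [rowLen_trap]; lia), colSum]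
  have h1 : ∑ v ∈ Finset.range (2 * h), (trap p h).colLen v =
      ∑ v ∈ Finset.range (2 * h), (p + 2 * h - v) :=
    Finset.sum_congr rfl fun v hv => by
      rw [colLen_trap, if_pos (Finset.mem_range.1 hv)]
  rw [h1]
  have h2 := two_mul_sum_range_sub (show 2 * h ≤ p + 2 * h by lia)
  nlinarith

/-- Shapes with few rows occur in the squares of trapezoids. -/
theorem linked_trap {X : YoungDiagram} {p h : ℕ} (hX : X.colLen 0 ≤ h)
    (hc : X.card = h * (2 * p + 2 * h + 1)) : Linked ![X, trap p h, trap p h] := by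
  set L := 2 * p + 2 * h + 1 with hL
  have hcard : Fintype.card (Fin h × Fin L) = h * L := by simp
  obtain ⟨r₁, c₁, h₁, hk₁⟩ := exists_block_tab (α := Fin h × Fin L) X (fun x => x.2 * h + x.1)
    (by
      rintro ⟨a, o⟩ ⟨a', o'⟩ hk
      simp only at hk
      have e1 := a.2
      have e2 := a'.2
      have e3 : (o : ℕ) = o' := by
        rcases lt_trichotomy (o : ℕ) o' with h' | h' | h'
        · nlinarith
        · exact h'
        · nlinarith
      rw [e3] at hk
      exact Prod.ext (Fin.ext (by simpa using hk)) (Fin.ext e3))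
    (by
      rintro ⟨a, o⟩
      rw [hc]
      simp only
      have e1 := a.2
      have e2 := o.2
      nlinarith)
    (by rw [hcard, hc])
  obtain ⟨r₂, c₂, h₂, hk₂⟩ := exists_block_tab (α := Fin h × Fin L) (trap p h)
    (fun x => x.1 * L + x.2)
    (by
      rintro ⟨a, o⟩ ⟨a', o'⟩ hk
      simp only at hk
      have e1 := o.2
      have e2 := o'.2
      have e3 : (a : ℕ) = a' := by
        rcases lt_trichotomy (a : ℕ) a' with h' | h' | h'
        · nlinarith
        · exact h'
        · nlinarith
      rw [e3] at hk
      exact Prod.ext (Fin.ext e3) (Fin.ext (by simpa using hk)))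
    (by
      rintro ⟨a, o⟩
      rw [card_trap]
      simp only
      have e1 := a.2
      have e2 := o.2
      nlinarith)
    (by rw [hcard, card_trap])
  have hl₂ : ∀ q, c₂ q < 2 * h := fun q => by
    have := mem_iff_lt_rowLen.1 (h₂.mem q)
    rw [rowLen_trap] at this
    lia
  refine linked_of_transversal h₁ h₂ ?_ ?_
  · have aux : ∀ x y : Fin h × Fin L, c₁ x = c₁ y → c₂ x = c₂ y → ¬ x.1 < y.1 := by
      rintro ⟨a, o⟩ ⟨a', o'⟩ e1 e2 hlt
      have k1 := hk₁ (a, o)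
      have k1' := hk₁ (a', o')
      have k2 := hk₂ (a, o)
      have k2' := hk₂ (a', o')
      have m1 := mem_iff_lt_colLen.1 (h₁.mem (a, o))
      have m1' := mem_iff_lt_colLen.1 (h₁.mem (a', o'))
      have m2 := mem_iff_lt_colLen.1 (h₂.mem (a, o))
      have m2' := mem_iff_lt_colLen.1 (h₂.mem (a', o'))
      have n1 := X.colLen_anti 0 (c₁ (a', o')) (Nat.zero_le _)
      rw [e1] at k1 m1
      rw [e2] at k2 m2
      rw [colLen_trap, if_pos (hl₂ _)] at m2 m2'
      simp only [Fin.lt_def] at k1 k1' k2 k2' hlt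
      have f2 : (o : ℕ) ≤ o' + 1 := by
        by_contra! hlt'
        have : ((o' : ℕ) + 2) * h ≤ o * h := Nat.mul_le_mul_right h hlt'
        lia
      have f3 : ((a : ℕ) + 1) * L ≤ a' * L := Nat.mul_le_mul_right L hlt
      lia
    intro x y e1 e2
    have n1 := aux x y e1 e2
    have n2 := aux y x e1.symm e2.symm
    have e3 : x.1 = y.1 := le_antisymm (not_lt.1 n2) (not_lt.1 n1)
    have k1 := hk₁ x
    have k1' := hk₁ y
    have m1 := mem_iff_lt_colLen.1 (h₁.mem x)
    have m1' := mem_iff_lt_colLen.1 (h₁.mem y)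
    have n1 := X.colLen_anti 0 (c₁ y) (Nat.zero_le _)
    rw [e1] at k1 m1
    rw [e3] at k1
    refine Prod.ext e3 (Fin.ext ?_)
    rcases lt_trichotomy (x.2 : ℕ) y.2 with h' | h' | h'
    · have : ((x.2 : ℕ) + 1) * h ≤ y.2 * h := Nat.mul_le_mul_right h h'
      lia
    · exact h'
    · have : ((y.2 : ℕ) + 1) * h ≤ x.2 * h := Nat.mul_le_mul_right h h'
      lia
  · intro x y hxy
    rw [colLen_trap, colLen_trap, if_pos (hl₂ _), if_pos (hl₂ _)] at hxy
    have := hl₂ x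
    have := hl₂ y
    lia

end Trapezoid

namespace YoungDiagram

open Finset

lemma rowLen_colLen_zero (Y : YoungDiagram) : Y.rowLen (Y.colLen 0) = 0 :=
  Y.rowLen_eq_zero le_rfl

lemma lt_colLen_iff {Y : YoungDiagram} {i j : ℕ} : i < Y.colLen j ↔ j < Y.rowLen i := by
  rw [← mem_iff_lt_colLen, mem_iff_lt_rowLen]

lemma colLen_le_iff {Y : YoungDiagram} {i j : ℕ} : Y.colLen j ≤ i ↔ Y.rowLen i ≤ j := by
  rw [← not_lt, lt_colLen_iff, not_lt]

/-- The Young diagram obtained by applying a monotone function with `g 0 = 0` to the row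
lengths. -/
def mapRow (g : ℕ → ℕ) (hg : Monotone g) (Y : YoungDiagram) : YoungDiagram :=
  ofFun (fun i => g (Y.rowLen i)) (fun i j hij => hg (Y.rowLen_anti i j hij)) (Y.colLen 0)

lemma rowLen_mapRow {g : ℕ → ℕ} (hg : Monotone g) (h0 : g 0 = 0) (Y : YoungDiagram) (i : ℕ) :
    (mapRow g hg Y).rowLen i = g (Y.rowLen i) :=
  rowLen_ofFun _ (by rw [rowLen_colLen_zero, h0]) i

/-- The first `x` columns. -/
def takeCols (x : ℕ) (Y : YoungDiagram) : YoungDiagram :=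
  mapRow (fun m => min m x) (fun _ _ h => by simp only; lia) Y

/-- All columns but the first `x`. -/
def dropCols (x : ℕ) (Y : YoungDiagram) : YoungDiagram :=
  mapRow (fun m => m - x) (fun _ _ h => by simp only; lia) Y

/-- Every row is made `k` times as long. -/
def scale (k : ℕ) (Y : YoungDiagram) : YoungDiagram :=
  mapRow (fun m => k * m) (fun _ _ h => Nat.mul_le_mul_left k h) Y

/-- Every row length is divided by `k`, rounding down. -/
def shrink (k : ℕ) (Y : YoungDiagram) : YoungDiagram :=
  mapRow (fun m => m / k) (fun _ _ h => Nat.div_le_div_right h) Y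

@[simp] lemma rowLen_takeCols (x : ℕ) (Y : YoungDiagram) (i : ℕ) :
    (takeCols x Y).rowLen i = min (Y.rowLen i) x := rowLen_mapRow _ (by simp) _ _

@[simp] lemma rowLen_dropCols (x : ℕ) (Y : YoungDiagram) (i : ℕ) :
    (dropCols x Y).rowLen i = Y.rowLen i - x := rowLen_mapRow _ (by simp) _ _

@[simp] lemma rowLen_scale (k : ℕ) (Y : YoungDiagram) (i : ℕ) :
    (scale k Y).rowLen i = k * Y.rowLen i := rowLen_mapRow _ (by simp) _ _

@[simp] lemma rowLen_shrink (k : ℕ) (Y : YoungDiagram) (i : ℕ) :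
    (shrink k Y).rowLen i = Y.rowLen i / k := rowLen_mapRow _ (by simp) _ _

@[simp] lemma rowLen_bot (i : ℕ) : (⊥ : YoungDiagram).rowLen i = 0 := by
  rw [rowLen_eq_iff]
  simp

lemma sum_rowLen_eq_card (Y : YoungDiagram) {N : ℕ} (hN : Y.colLen 0 ≤ N) :
    ∑ i ∈ range N, Y.rowLen i = Y.card := by
  rw [← card_transpose, ← colSum_eq_card (j := N) _ (by simpa using hN), colSum]
  simp

lemma sum_rowLen_le_card (Y : YoungDiagram) (N : ℕ) : ∑ i ∈ range N, Y.rowLen i ≤ Y.card := by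
  rw [← card_transpose]
  refine le_trans (le_of_eq ?_) (colSum_le_card _ N)
  simp [colSum]

lemma card_rowAdd (Y Z : YoungDiagram) : (rowAdd Y Z).card = Y.card + Z.card := by
  have h : (rowAdd Y Z).colLen 0 ≤ Y.colLen 0 + Z.colLen 0 := by
    rw [colLen_le_iff, rowLen_rowAdd, rowLen_eq_zero _ (by lia), rowLen_eq_zero _ (by lia)]
  rw [← sum_rowLen_eq_card _ h, ← sum_rowLen_eq_card Y (N := Y.colLen 0 + Z.colLen 0) (by lia),
    ← sum_rowLen_eq_card Z (N := Y.colLen 0 + Z.colLen 0) (by lia), ← sum_add_distrib]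
  simp

lemma card_scale (k : ℕ) (Y : YoungDiagram) : (scale k Y).card = k * Y.card := by
  have h : (scale k Y).colLen 0 ≤ Y.colLen 0 := by
    rw [colLen_le_iff, rowLen_scale, rowLen_eq_zero _ le_rfl, mul_zero]
  rw [← sum_rowLen_eq_card _ h, ← sum_rowLen_eq_card Y le_rfl, mul_sum]
  simp

lemma rowAdd_takeCols_dropCols (x : ℕ) (Y : YoungDiagram) :
    rowAdd (takeCols x Y) (dropCols x Y) = Y :=
  ext_rowLen fun i => by
    rw [rowLen_rowAdd, rowLen_takeCols, rowLen_dropCols]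
    lia

lemma colLen_takeCols {x j : ℕ} (hj : j < x) (Y : YoungDiagram) :
    (takeCols x Y).colLen j = Y.colLen j := by
  rw [colLen_eq_iff]
  intro i
  rw [mem_iff_lt_rowLen, rowLen_takeCols, lt_colLen_iff]
  lia

lemma colLen_dropCols (x j : ℕ) (Y : YoungDiagram) :
    (dropCols x Y).colLen j = Y.colLen (x + j) := by
  rw [colLen_eq_iff]
  intro i
  rw [mem_iff_lt_rowLen, rowLen_dropCols, lt_colLen_iff]
  lia

lemma card_takeCols (x : ℕ) (Y : YoungDiagram) : (takeCols x Y).card = Y.colSum x := by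
  rw [← colSum_eq_card (j := x) _ (by simp), colSum, colSum]
  exact sum_congr rfl fun j hj => colLen_takeCols (mem_range.1 hj) Y

lemma colSum_add_card_dropCols (x : ℕ) (Y : YoungDiagram) :
    Y.colSum x + (dropCols x Y).card = Y.card := by
  rw [← card_takeCols, ← card_rowAdd, rowAdd_takeCols_dropCols]

lemma rowAdd_le {Y Y' Z Z' : YoungDiagram} (h : Y ≤ Y') (h' : Z ≤ Z') :
    rowAdd Y Z ≤ rowAdd Y' Z' := by
  rw [le_iff_rowLen] at *
  intro i
  rw [rowLen_rowAdd, rowLen_rowAdd]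
  exact add_le_add (h i) (h' i)

lemma card_le_card {Y Z : YoungDiagram} (h : Y ≤ Z) : Y.card ≤ Z.card := Finset.card_le_card h

/-- A nonempty diagram contains a diagram with one cell less. -/
lemma exists_le_card_pred {Y : YoungDiagram} {m : ℕ} (h : Y.card = m + 1) :
    ∃ Z ≤ Y, Z.card = m := by
  have hpos : 0 < Y.colLen 0 := by
    by_contra! h0
    rw [← sum_rowLen_eq_card Y h0] at h
    simp at h
  obtain ⟨i, hi⟩ : ∃ i, Y.colLen 0 = i + 1 := ⟨_, (Nat.sub_add_cancel hpos).symm⟩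
  have hr : 0 < Y.rowLen i := by rw [← lt_colLen_iff]; lia
  have hr' : Y.rowLen (i + 1) = 0 := Y.rowLen_eq_zero (by lia)
  have hmem : (i, Y.rowLen i - 1) ∈ Y := by rw [mem_iff_lt_rowLen]; lia
  refine ⟨⟨Y.cells.erase (i, Y.rowLen i - 1), ?_⟩, fun x hx => ?_, ?_⟩
  · rintro ⟨a, b⟩ ⟨a', b'⟩ ⟨h1, h2⟩ hx
    simp only [coe_erase, Set.mem_sdiff, Set.mem_singleton_iff, Finset.mem_coe, mem_cells,
      Prod.mk.injEq] at hx h1 h2 ⊢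
    refine ⟨Y.isLowerSet (show (a', b') ≤ (a, b) from ⟨h1, h2⟩) hx.1, ?_⟩
    rintro ⟨rfl, rfl⟩
    have e1 := mem_iff_lt_rowLen.1 hx.1
    refine hx.2 ?_
    rcases h1.eq_or_lt with e | e
    · subst e
      exact ⟨rfl, by lia⟩
    · have := Y.rowLen_anti (a' + 1) a e
      lia
  · exact Finset.erase_subset _ _ hx
  · exact (card_erase_of_mem hmem).trans (by rw [show #Y.cells = m + 1 from h]; rfl)

lemma exists_le_card_eq {Y : YoungDiagram} {m : ℕ} (h : m ≤ Y.card) : ∃ Z ≤ Y, Z.card = m := by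
  obtain ⟨k, hk⟩ := Nat.exists_eq_add_of_le h
  induction k generalizing Y with
  | zero => exact ⟨Y, le_rfl, hk⟩
  | succ k ih =>
    obtain ⟨Z, hZ, hZc⟩ := exists_le_card_pred (Y := Y) (m := m + k) (by lia)
    obtain ⟨Z', hZ', hc⟩ := ih (by lia) hZc
    exact ⟨Z', hZ'.trans hZ, hc⟩

/-- The staircase with rows of lengths `r, r - 1, …, 1`. -/
def stair (r : ℕ) : YoungDiagram := ofFun (fun i => r - i) (fun i j h => by simp only; lia) r

@[simp] lemma rowLen_stair (r i : ℕ) : (stair r).rowLen i = r - i := rowLen_ofFun _ (by simp) i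

@[simp] lemma transpose_stair (r : ℕ) : (stair r).transpose = stair r :=
  ext_rowLen fun i => by
    rw [rowLen_transpose, rowLen_stair, colLen_eq_iff]
    intro j
    rw [mem_iff_lt_rowLen, rowLen_stair]
    lia

lemma stair_mono {r s : ℕ} (h : r ≤ s) : stair r ≤ stair s := by
  rw [le_iff_rowLen]
  intro i
  simp only [rowLen_stair]
  lia

lemma transpose_le_stair {Y : YoungDiagram} {r : ℕ} (h : Y ≤ stair r) : Y.transpose ≤ stair r := by
  rw [← transpose_stair]
  exact YoungDiagram.transpose_mono h

end YoungDiagram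

open YoungDiagram

lemma trap_zero (t : ℕ) : trap 0 t = stair (2 * t) :=
  ext_rowLen fun i => by rw [rowLen_trap, rowLen_stair]; lia

lemma rowAdd_stair_trap (p h : ℕ) :
    rowAdd (stair p) (trap p h) = stair (p + 2 * h) := by
  refine ext_rowLen fun i => ?_
  simp only [rowLen_rowAdd, rowLen_stair, rowLen_trap]
  lia

lemma linked_bot : Linked ![⊥, ⊥, ⊥] := by
  have h : IsTab ⊥ (fun _ : Fin 0 => 0) (fun _ => 0) :=
    ⟨fun p => p.elim0, fun p => p.elim0, fun i j hij => absurd hij (by simp)⟩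
  refine ⟨Fin 0, inferInstance, inferInstance, fun _ g => E (fun _ => 0) (fun _ => 0) (1 * g),
    fun i => ?_, ?_⟩
  · fin_cases i <;> exact ⟨_, _, h, 1, rfl⟩
  · rw [Fintype.sum_eq_single 1 fun g hg => absurd (Subsingleton.elim g 1) hg]
    simp [h.E_one]

lemma Linked.rowAdd₃ {X X' Y Y' Z Z' : YoungDiagram} (h : Linked ![X, Y, Z])
    (h' : Linked ![X', Y', Z']) :
    Linked ![X.rowAdd X', Y.rowAdd Y', Z.rowAdd Z'] := by
  convert h.rowAdd h' using 1
  funext i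
  fin_cases i <;> rfl

lemma Linked.transpose₀₁ {X Y Z : YoungDiagram} (h : Linked ![X, Y, Z]) :
    Linked ![X.transpose, Y.transpose, Z] := by
  have h1 : Linked ![Z, X, Y] := by
    convert h.perm (finRotate 3)⁻¹ using 1
    funext i
    fin_cases i <;> rfl
  convert h1.transpose.perm (finRotate 3) using 1
  funext i
  fin_cases i <;> rfl

lemma Linked.scale₃ {X Y Z : YoungDiagram} (h : Linked ![X, Y, Z]) (k : ℕ) :
    Linked ![X.scale k, Y.scale k, Z.scale k] := by
  induction k with
  | zero =>
    have h0 : ∀ Y : YoungDiagram, Y.scale 0 = ⊥ := fun Y => ext_rowLen fun i => by simp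
    simpa only [h0] using linked_bot
  | succ k ih =>
    have h0 : ∀ Y : YoungDiagram, Y.scale (k + 1) = (Y.scale k).rowAdd Y :=
      fun Y => ext_rowLen fun i => by simp [add_mul]
    simpa only [h0] using ih.rowAdd₃ h

/-- Up to `w` cells, `Y` occurs in a product of two subdiagrams of the staircase `stair r`. -/
def NearStair (r w : ℕ) (Y : YoungDiagram) : Prop :=
  ∃ Y' ≤ Y, ∃ U ≤ stair r, ∃ V ≤ stair r, Linked ![Y', U, V] ∧ Y.card ≤ Y'.card + w

lemma nearStair_of_card_le {r w : ℕ} {Y : YoungDiagram} (h : Y.card ≤ w) : NearStair r w Y :=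
  ⟨⊥, bot_le, ⊥, bot_le, ⊥, bot_le, linked_bot, by lia⟩

lemma NearStair.mono {r r' w w' : ℕ} {Y : YoungDiagram} (h : NearStair r w Y) (hr : r ≤ r')
    (hw : w ≤ w') : NearStair r' w' Y := by
  obtain ⟨Y', hY, U, hU, V, hV, hL, hc⟩ := h
  exact ⟨Y', hY, U, hU.trans (stair_mono hr), V, hV.trans (stair_mono hr), hL, by lia⟩

lemma NearStair.transpose {r w : ℕ} {Y : YoungDiagram} (h : NearStair r w Y) :
    NearStair r w Y.transpose := by
  obtain ⟨Y', hY, U, hU, V, hV, hL, hc⟩ := h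
  refine ⟨_, YoungDiagram.transpose_mono hY, _, transpose_le_stair hU, V, hV, hL.transpose₀₁, ?_⟩
  rwa [card_transpose, card_transpose]

/-- Cutting off the first columns when what remains has few rows. -/
lemma NearStair.of_takeCols {r w x p h : ℕ} {Y : YoungDiagram} (hT : NearStair p w (Y.takeCols x))
    (hp : p + 2 * h ≤ r) (hh : Y.colLen x ≤ h) {w' : ℕ}
    (h1 : Y.colSum x + h * (2 * p + 2 * h + 1) ≤ Y.card)
    (h2 : Y.card ≤ Y.colSum x + h * (2 * p + 2 * h + 1) + w') : NearStair r (w + w') Y := by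
  obtain ⟨Y', hY, U, hU, V, hV, hL, hc⟩ := hT
  have hd := colSum_add_card_dropCols x Y
  obtain ⟨T, hT, hTc⟩ := exists_le_card_eq (Y := Y.dropCols x) (m := h * (2 * p + 2 * h + 1))
    (by lia)
  have hTr : T.colLen 0 ≤ h := by
    rw [colLen_le_iff] at hh ⊢
    have := le_iff_rowLen.1 hT h
    rw [rowLen_dropCols] at this
    lia
  have hst : ∀ U ≤ stair p, U.rowAdd (trap p h) ≤ stair r := fun U hU =>
    (rowAdd_le hU le_rfl).trans (by rw [rowAdd_stair_trap]; exact stair_mono hp)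
  refine ⟨Y'.rowAdd T, ?_, _, hst U hU, _, hst V hV, hL.rowAdd₃ (linked_trap hTr hTc), ?_⟩
  · exact (rowAdd_le hY hT).trans_eq (rowAdd_takeCols_dropCols x Y)
  · rw [card_takeCols] at hc
    rw [card_rowAdd]
    lia

/-- A diagram with few rows contains a diagram of the size of a self-conjugate staircase that
occurs in its square. -/
lemma exists_le_linked_stair {U : YoungDiagram} {t : ℕ} (ht : 5 ≤ t)
    (hU : t * (2 * t + 1) + 4 * t + 3 ≤ U.card)
    (hsmall : ∀ y, 2 * y + 3 ≤ U.colLen y → 5 * (y + 1) ≤ t ∧ 25 * U.colSum (y + 1) ≤ 2 * t ^ 2) :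
    ∃ U' ≤ U, U'.card = t * (2 * t + 1) ∧ Linked ![U', stair (2 * t), stair (2 * t)] := by
  obtain ⟨y, hy1, hy2, hy3, hy4⟩ : ∃ y, y * (2 * y + 1) ≤ U.colSum y ∧ U.colLen y ≤ 2 * y + 2 ∧
      5 * y ≤ t ∧ 25 * U.colSum y ≤ 2 * t ^ 2 := by
    have hex : ∃ y, U.colLen y ≤ 2 * y + 2 := by
      refine ⟨t, ?_⟩
      by_contra! h
      have := hsmall t h
      lia
    classical
    refine ⟨Nat.find hex, ?_, Nat.find_spec hex, ?_⟩
    · have h1 : ∀ j ∈ Finset.range (Nat.find hex), 2 * Nat.find hex + 1 ≤ U.colLen j := by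
        intro j hj
        rw [Finset.mem_range] at hj
        have h2 := Nat.find_min hex (m := Nat.find hex - 1) (by lia)
        have h3 := U.colLen_anti j (Nat.find hex - 1) (by lia)
        lia
      simpa [colSum] using Finset.card_nsmul_le_sum _ _ _ h1
    · rcases Nat.eq_zero_or_pos (Nat.find hex) with h0 | h0
      · rw [h0]
        simp [colSum]
      · have h2 := Nat.find_min hex (m := Nat.find hex - 1) (by lia)
        have := hsmall (Nat.find hex - 1) (by lia)
        rwa [Nat.sub_add_cancel h0] at this
  obtain ⟨k, hk1, hk2⟩ : ∃ k, k * (2 * k + 1) ≤ U.colSum y ∧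
      U.colSum y < (k + 1) * (2 * (k + 1) + 1) := by
    have hex : ∃ k, U.colSum y < (k + 1) * (2 * (k + 1) + 1) := ⟨U.colSum y, by nlinarith⟩
    classical
    refine ⟨Nat.find hex, ?_, Nat.find_spec hex⟩
    rcases Nat.eq_zero_or_pos (Nat.find hex) with h0 | h0
    · simp [h0]
    · have h2 := Nat.find_min hex (m := Nat.find hex - 1) (by lia)
      rw [Nat.sub_add_cancel h0] at h2
      lia
  have hky : y ≤ k := by
    by_contra! h
    have : (k + 1) * (2 * (k + 1) + 1) ≤ y * (2 * y + 1) := by gcongr <;> lia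
    lia
  have hkt : 5 * k ≤ t := by
    by_contra! h
    nlinarith
  have hsplit := colSum_add_card_dropCols y U
  obtain ⟨Q, hQ, hQc⟩ := exists_le_card_eq (Y := U.takeCols y) (m := k * (2 * k + 1))
    (by rwa [card_takeCols])
  obtain ⟨h, rfl⟩ := Nat.exists_eq_add_of_le (show k ≤ t by lia)
  obtain ⟨T, hT, hTc⟩ := exists_le_card_eq (Y := U.dropCols y)
    (m := h * (2 * (2 * k) + 2 * h + 1)) (by nlinarith)
  have hQL : Linked ![Q, stair (2 * k), stair (2 * k)] := by
    have h1 : Q.transpose.colLen 0 ≤ k := by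
      have := le_iff_rowLen.1 hQ 0
      rw [rowLen_takeCols] at this
      rw [colLen_transpose]
      lia
    have := (linked_trap (p := 0) h1 (by rw [card_transpose, hQc]; ring)).transpose₀₁
    simpa [trap_zero, transpose_transpose] using this
  have hTL : Linked ![T, trap (2 * k) h, trap (2 * k) h] := by
    refine linked_trap ?_ hTc
    rw [colLen_le_iff] at hy2 ⊢
    have h1 := le_iff_rowLen.1 hT h
    rw [rowLen_dropCols] at h1
    have h2 := U.rowLen_anti (2 * y + 2) h (by lia)
    lia
  refine ⟨Q.rowAdd T, (rowAdd_le hQ hT).trans_eq (rowAdd_takeCols_dropCols y U), ?_, ?_⟩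
  · rw [card_rowAdd, hQc, hTc]
    ring
  · have := hQL.rowAdd₃ hTL
    rwa [rowAdd_stair_trap, ← mul_add] at this

/-- Combining `N ^ 2` pieces into a square grid of staircases. -/
lemma linked_grid {P S : YoungDiagram} {s : ℕ} (N : ℕ) (hP : Linked ![P, stair s, stair s])
    (hS : Linked ![S, stair s, stair s]) :
    ∃ X ≤ stair ((N + 1) * (s + 1)),
      Linked ![P.rowAdd (S.scale ((N + 1) ^ 2 - 1)), X, X] := by
  set Z := ((stair s).scale (N + 1)).transpose with hZ
  have h1 : Linked ![S.scale (N + 1), Z, Z] := (hS.scale₃ (N + 1)).transpose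
  have h2 : Linked ![P.rowAdd (S.scale N), Z, Z] := by
    have := (hP.rowAdd₃ (hS.scale₃ N)).transpose
    have e : (stair s).rowAdd ((stair s).scale N) = (stair s).scale (N + 1) :=
      ext_rowLen fun i => by
        simp only [rowLen_rowAdd, rowLen_scale]
        ring
    rwa [e] at this
  have h3 := h2.rowAdd₃ (h1.scale₃ N)
  have e1 : (P.rowAdd (S.scale N)).rowAdd ((S.scale (N + 1)).scale N) =
      P.rowAdd (S.scale ((N + 1) ^ 2 - 1)) := ext_rowLen fun i => by
    simp only [rowLen_rowAdd, rowLen_scale]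
    rw [show (N + 1) ^ 2 - 1 = N + N * (N + 1) by
      rw [show (N + 1) ^ 2 = N + N * (N + 1) + 1 by ring]; rfl]
    ring
  rw [e1] at h3
  refine ⟨_, ?_, h3⟩
  rw [le_iff_rowLen]
  intro i
  rw [rowLen_rowAdd, rowLen_scale, rowLen_stair]
  have hb : Z.rowLen i ≤ s - i / (N + 1) := by
    rw [hZ, rowLen_transpose, colLen_le_iff, rowLen_scale, rowLen_stair]
    have h4 := Nat.div_add_mod i (N + 1)
    have h5 : s - (s - i / (N + 1)) ≤ i / (N + 1) := by lia
    calc _ ≤ (N + 1) * (i / (N + 1)) := Nat.mul_le_mul_left _ h5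
      _ ≤ i := by lia
  have h4 := Nat.div_add_mod i (N + 1)
  have h6 := Nat.mod_lt i (Nat.succ_pos N)
  rcases le_total s (i / (N + 1)) with h | h
  · have : Z.rowLen i = 0 := by lia
    simp [this]
  · obtain ⟨d, hd⟩ := Nat.exists_eq_add_of_le h
    have h7 : Z.rowLen i ≤ d := by lia
    have h8 : N * Z.rowLen i ≤ N * d := Nat.mul_le_mul_left _ h7
    refine le_trans (show _ ≤ (N + 1) * d by lia) ?_
    rw [Nat.le_sub_iff_add_le]
    · generalize i / (N + 1) = m at *
      subst hd
      nlinarith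
    · generalize i / (N + 1) = m at *
      subst hd
      nlinarith

lemma card_le_card_shrink (S : YoungDiagram) {M : ℕ} (hM : 0 < M) :
    S.card ≤ M * (S.shrink M).card + M * S.colLen 0 := by
  rw [← sum_rowLen_eq_card S le_rfl]
  refine le_trans ?_ (add_le_add_left (Nat.mul_le_mul_left M
    (sum_rowLen_le_card (S.shrink M) (S.colLen 0))) _)
  rw [Finset.mul_sum, mul_comm M (S.colLen 0), ← smul_eq_mul (S.colLen 0) M]
  nth_rewrite 3 [← Finset.card_range (S.colLen 0)]
  rw [← Finset.sum_const, ← Finset.sum_add_distrib]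
  refine Finset.sum_le_sum fun i _ => ?_
  rw [rowLen_shrink]
  have h1 := Nat.div_add_mod (S.rowLen i) M
  have h2 := Nat.mod_lt (S.rowLen i) hM
  lia

lemma row_sum_bound {S : YoungDiagram} {x t y : ℕ} (hx : 25 * x ≤ t)
    (hR : 25 * (S.dropCols x).card ≤ t ^ 2) (hy : 2 * y + 3 ≤ S.rowLen y) :
    5 * (y + 1) ≤ t ∧ 25 * ∑ i ∈ Finset.range (y + 1), S.rowLen i ≤ 2 * t ^ 2 := by
  have h1 := sum_rowLen_le_card (S.dropCols x) (y + 1)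
  simp only [rowLen_dropCols] at h1
  have h5 : 5 * (y + 1) ≤ t := by
    by_contra! h
    have h2 : ∀ i ∈ Finset.range (y + 1), y + 1 ≤ S.rowLen i - x := by
      intro i hi
      have := S.rowLen_anti i y (by rw [Finset.mem_range] at hi; lia)
      lia
    have h3 := Finset.card_nsmul_le_sum _ _ _ h2
    simp only [Finset.card_range, smul_eq_mul] at h3
    nlinarith
  refine ⟨h5, ?_⟩
  have h2 : ∑ i ∈ Finset.range (y + 1), S.rowLen i ≤
      ∑ i ∈ Finset.range (y + 1), (S.rowLen i - x) + (y + 1) * x := by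
    have e : (y + 1) * x = ∑ _i ∈ Finset.range (y + 1), x := by simp
    rw [e, ← Finset.sum_add_distrib]
    exact Finset.sum_le_sum fun i _ => by lia
  nlinarith

/-- A diagram with boundedly thin head and no long tails contains a square grid of pieces. -/
lemma exists_le_linked_grid {Y : YoungDiagram} {r t N x X₁ X₂ : ℕ} (hN : 0 < N) (ht : 5 ≤ t)
    (h1 : t * (2 * t + 1) ≤ Y.colSum t)
    (h2 : 2 * (Y.transpose.dropCols X₂).card < t * (2 * t + 1))
    (h3 : X₁ ≤ ((N + 1) ^ 2 - 1) * x) (h4 : 25 * x ≤ t)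
    (h5 : 25 * (Y.dropCols X₁).card ≤ ((N + 1) ^ 2 - 1) * t ^ 2)
    (h6 : t * (2 * t + 1) + 2 * X₂ + ((N + 1) ^ 2 - 1) * (t * (2 * t + 1) + 4 * t + 3) +
      ((N + 1) ^ 2 - 1) * (2 * X₂) ≤ Y.card)
    (h7 : (N + 1) * (2 * t + 1) ≤ r) :
    ∃ Y' ≤ Y, ∃ X ≤ stair r, Linked ![Y', X, X] ∧ Y'.card = (N + 1) ^ 2 * (t * (2 * t + 1)) := by
  have hMpos : 0 < (N + 1) ^ 2 - 1 := by
    have : (N + 1) ^ 2 = N * N + 2 * N + 1 := by ring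
    have : 0 < N * N := by positivity
    lia
  have hMsucc : (N + 1) ^ 2 = (N + 1) ^ 2 - 1 + 1 := by
    have : 0 < (N + 1) ^ 2 := by positivity
    lia
  generalize hM : (N + 1) ^ 2 - 1 = M at *
  generalize hτ : t * (2 * t + 1) = τ at *
  obtain ⟨z, hz1, hz2, hz3⟩ : ∃ z, z + 1 ≤ t ∧ Y.colSum z < τ ∧ τ ≤ Y.colSum (z + 1) := by
    classical
    have hex : ∃ z, τ ≤ Y.colSum z := ⟨t, h1⟩
    have hpos : 0 < Nat.find hex := by
      rw [Nat.find_pos]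
      simp only [colSum, Finset.range_zero, Finset.sum_empty]
      lia
    refine ⟨Nat.find hex - 1, ?_, ?_, ?_⟩
    · rw [Nat.sub_add_cancel hpos]
      exact Nat.find_min' hex h1
    · exact not_le.1 (Nat.find_min hex (by lia))
    · rw [Nat.sub_add_cancel hpos]
      exact Nat.find_spec hex
  have hcol : Y.colLen z ≤ 2 * X₂ := by
    by_contra! hlt
    have e1 := sum_rowLen_le_card (Y.transpose.dropCols X₂) (z + 1)
    have e2 : Y.colSum (z + 1) ≤
        2 * ∑ i ∈ Finset.range (z + 1), (Y.transpose.dropCols X₂).rowLen i := by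
      rw [colSum, Finset.mul_sum]
      refine Finset.sum_le_sum fun i hi => ?_
      rw [rowLen_dropCols, rowLen_transpose]
      have := Y.colLen_anti i z (by rw [Finset.mem_range] at hi; lia)
      lia
    lia
  have hz4 := Y.colSum_succ z
  obtain ⟨P, hP, hPc⟩ := exists_le_card_eq (Y := Y.takeCols (z + 1)) (m := τ)
    (by rwa [card_takeCols])
  have hPL : Linked ![P, stair (2 * t), stair (2 * t)] := by
    have e1 : P.transpose.colLen 0 ≤ t := by
      have := le_iff_rowLen.1 hP 0
      rw [rowLen_takeCols] at this
      rw [colLen_transpose]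
      lia
    have := (linked_trap (p := 0) e1 (by rw [card_transpose, hPc, ← hτ]; ring)).transpose₀₁
    simpa [trap_zero, transpose_transpose] using this
  have hsplit := colSum_add_card_dropCols (z + 1) Y
  set S := Y.dropCols (z + 1) with hS
  have hScol : S.colLen 0 ≤ 2 * X₂ := by
    rw [hS, colLen_dropCols]
    exact (Y.colLen_anti z _ (by lia)).trans hcol
  have hSc := card_le_card_shrink S hMpos
  have hbig : τ + 4 * t + 3 ≤ (S.shrink M).card := by
    have e1 : M * S.colLen 0 ≤ M * (2 * X₂) := Nat.mul_le_mul_left _ hScol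
    exact Nat.le_of_mul_le_mul_left (by lia : M * _ ≤ M * _) hMpos
  have hR : 25 * ((S.shrink M).dropCols x).card ≤ t ^ 2 := by
    have e1 : ((S.shrink M).dropCols x).scale M ≤ Y.dropCols X₁ := by
      rw [le_iff_rowLen]
      intro i
      simp only [rowLen_scale, rowLen_dropCols, rowLen_shrink, hS]
      rw [Nat.mul_sub]
      have := Nat.mul_div_le (Y.rowLen i - (z + 1)) M
      lia
    have e2 := YoungDiagram.card_le_card e1
    rw [card_scale] at e2
    refine Nat.le_of_mul_le_mul_left (?_ : M * _ ≤ M * _) hMpos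
    lia
  obtain ⟨U, hU, hUc, hUL⟩ := exists_le_linked_stair (U := (S.shrink M).transpose) (t := t) ht
    (by rwa [card_transpose, hτ]) (fun y hy => by
      rw [colLen_transpose] at hy
      simpa [colSum] using row_sum_bound h4 hR hy)
  have hUL' := hUL.transpose₀₁
  rw [transpose_stair] at hUL'
  obtain ⟨X, hX, hXL⟩ := linked_grid N hPL hUL'
  rw [hM] at hXL
  refine ⟨_, ?_, X, hX.trans (stair_mono h7), hXL, ?_⟩
  · rw [le_iff_rowLen]
    intro i
    have e1 := le_iff_rowLen.1 hP i
    have e2 := le_iff_rowLen.1 (YoungDiagram.transpose_mono hU) i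
    rw [transpose_transpose, rowLen_shrink, hS, rowLen_dropCols] at e2
    rw [rowLen_takeCols] at e1
    rw [rowLen_rowAdd, rowLen_scale]
    have e3 := Nat.mul_le_mul_left M e2
    have e4 := Nat.mul_div_le (Y.rowLen i - (z + 1)) M
    lia
  · rw [card_rowAdd, card_scale, card_transpose, hPc, hUc, hτ, hMsucc]
    ring

/-- The inductive step when the diagram has a proper head of columns with a short tail. -/
lemma nearStair_of_head {m C r : ℕ} (hC : 4 * m ≤ C)
    (ih : ∀ p < r, ∀ Y : YoungDiagram, 2 * Y.card ≤ p ^ 2 → NearStair p (C * p) Y)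
    {Y : YoungDiagram} (h1 : (r - 1) ^ 2 < 2 * Y.card) (h2 : 2 * Y.card ≤ r ^ 2) {x q : ℕ}
    (hx : 2 * Y.colSum x ≤ q ^ 2) (hq : m * q + r ≤ m * r) (hlt : 2 * Y.colLen x + q + 1 < r) :
    NearStair r (C * r) Y := by
  classical
  have hex : ∃ p, 2 * Y.colSum x ≤ p ^ 2 := ⟨q, hx⟩
  obtain ⟨p, hpq, hp1, hp2⟩ : ∃ p ≤ q, 2 * Y.colSum x ≤ p ^ 2 ∧ p ^ 2 ≤ 2 * Y.colSum x + 2 * p := by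
    refine ⟨Nat.find hex, Nat.find_min' hex hx, Nat.find_spec hex, ?_⟩
    rcases Nat.eq_zero_or_pos (Nat.find hex) with h0 | h0
    · simp [h0]
    · have := Nat.find_min hex (m := Nat.find hex - 1) (by lia)
      obtain ⟨k, hk⟩ := Nat.exists_eq_add_of_lt h0
      rw [hk] at this ⊢
      simp only [zero_add, Nat.add_sub_cancel] at this ⊢
      nlinarith
  obtain ⟨h, e, he, hr⟩ : ∃ h e, (e = 2 ∨ e = 3) ∧ r = p + 2 * h + e :=
    ⟨(r - 2 - p) / 2, r - p - 2 * ((r - 2 - p) / 2), by lia, by lia⟩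
  have hT := ih p (by lia) (Y.takeCols x) (by rwa [card_takeCols])
  have hm : m * p ≤ m * q := Nat.mul_le_mul_left _ hpq
  refine (hT.of_takeCols (r := r) (h := h) (w' := 4 * r) (by lia) (by lia) ?_ ?_).mono le_rfl ?_
  · have : (p + 2 * h + 1) ^ 2 ≤ (r - 1) ^ 2 := Nat.pow_le_pow_left (by lia) 2
    nlinarith
  · subst hr
    rcases he with rfl | rfl <;> nlinarith
  · obtain ⟨d, hd⟩ := Nat.exists_eq_add_of_le (show p ≤ r by lia)
    have h3 : r ≤ m * d := by
      have : m * r = m * p + m * d := by rw [← mul_add, ← hd]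
      lia
    have h4 : 4 * m * d ≤ C * d := Nat.mul_le_mul_right _ hC
    calc C * p + 4 * r ≤ C * p + C * d := by lia
      _ = C * r := by rw [← mul_add, ← hd]

/-- If no proper head of columns has a short tail, most cells lie in linearly many columns. -/
lemma card_dropCols_le {m m' r : ℕ} (hm : m' ≤ m) (hm' : 0 < m') (hr : 2 * m' < r)
    {Y : YoungDiagram} (h2 : 2 * Y.card ≤ r ^ 2)
    (H : ∀ x q, 2 * Y.colSum x ≤ q ^ 2 → m * q + r ≤ m * r → r ≤ 2 * Y.colLen x + q + 1) :
    m' * (Y.dropCols (2 * m' * r)).card ≤ r ^ 2 + m' * r := by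
  obtain ⟨d, hd1, hd2⟩ : ∃ d, r ≤ m' * d ∧ m' * d < r + m' := by
    refine ⟨(r + m' - 1) / m', ?_, ?_⟩
    · have := Nat.lt_mul_div_succ (r + m' - 1) hm'
      rw [mul_add] at this
      lia
    · have := Nat.mul_div_le (r + m' - 1) m'
      lia
  have hdr : d ≤ r := by
    by_contra! h
    have : m' * (r + 1) ≤ m' * d := Nat.mul_le_mul_left _ h
    nlinarith
  obtain ⟨q, rfl⟩ := Nat.exists_eq_add_of_le hdr
  have hcond : m * q + (d + q) ≤ m * (d + q) := by
    have : m' * d ≤ m * d := Nat.mul_le_mul_right _ hm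
    rw [mul_add]
    lia
  have hbig : q ^ 2 < 2 * Y.colSum (2 * m' * (d + q)) := by
    by_contra! hle
    have h3 := H _ q hle hcond
    have h4 : 2 * m' * (d + q) * Y.colLen (2 * m' * (d + q)) ≤ Y.colSum (2 * m' * (d + q)) := by
      have := Finset.card_nsmul_le_sum (Finset.range (2 * m' * (d + q))) Y.colLen
        (Y.colLen (2 * m' * (d + q)))
        (fun j hj => Y.colLen_anti j _ (Finset.mem_range.1 hj).le)
      simpa [colSum] using this
    generalize Y.colLen (2 * m' * (d + q)) = c at *
    have h5 : 2 * m' * (d + q) * d ≤ 2 * m' * (d + q) * (2 * c + 1) :=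
      Nat.mul_le_mul_left _ (by lia)
    have h6 : 2 * (d + q) * (d + q) ≤ 2 * (d + q) * (m' * d) := Nat.mul_le_mul_left _ hd1
    have h7 : 2 * m' * (d + q) < (d + q) * (d + q) :=
      Nat.mul_lt_mul_of_pos_right hr (by lia)
    nlinarith
  have h3 := colSum_add_card_dropCols (2 * m' * (d + q)) Y
  generalize (Y.dropCols (2 * m' * (d + q))).card = D at *
  have h8 : 2 * D + q ^ 2 ≤ (d + q) ^ 2 := by lia
  nlinarith

/-- Large diagrams without a proper head of columns or rows with a short tail. -/
lemma nearStair_of_no_head {r : ℕ} (hr : 10 ^ 25 ≤ r) {Y : YoungDiagram}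
    (h1 : (r - 1) ^ 2 < 2 * Y.card) (h2 : 2 * Y.card ≤ r ^ 2)
    (H : ∀ x q, 2 * Y.colSum x ≤ q ^ 2 → 10 ^ 12 * q + r ≤ 10 ^ 12 * r →
      r ≤ 2 * Y.colLen x + q + 1)
    (H' : ∀ x q, 2 * Y.transpose.colSum x ≤ q ^ 2 → 10 ^ 12 * q + r ≤ 10 ^ 12 * r →
      r ≤ 2 * Y.transpose.colLen x + q + 1) : NearStair r (10 ^ 26 * r) Y := by
  have hD1 := card_dropCols_le (m' := 400) (by norm_num) (by norm_num) (by lia) h2 H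
  have hD2 := card_dropCols_le (m' := 10 ^ 12) (le_refl _) (by norm_num) (by lia)
    (by rwa [card_transpose]) H'
  obtain ⟨s, rfl⟩ := Nat.exists_eq_add_of_le (show 10 ^ 23 ≤ r by lia)
  obtain ⟨t, ht1, ht2⟩ : ∃ t, 200000 * t ≤ s ∧ s < 200000 * t + 200000 :=
    ⟨s / 200000, by lia, by lia⟩
  obtain ⟨x, hx1, hx2⟩ : ∃ x, 25 * x ≤ t ∧ t < 25 * x + 25 := ⟨t / 25, by lia, by lia⟩
  set r := 10 ^ 23 + s with hrs
  have q1 : 9604 * r ^ 2 ≤ 4 * 10 ^ 14 * t ^ 2 := by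
    have := Nat.pow_le_pow_left (show 98 * r ≤ 2 * 10 ^ 7 * t by lia) 2
    rw [mul_pow, mul_pow] at this
    norm_num at this ⊢
    exact this
  have q2 : 10 ^ 25 * r ≤ r ^ 2 := by
    rw [sq]
    exact Nat.mul_le_mul_right _ hr
  have q3 : 4 * 10 ^ 10 * t ^ 2 ≤ s ^ 2 := by
    have := Nat.pow_le_pow_left ht1 2
    rw [mul_pow] at this
    norm_num at this ⊢
    exact this
  have q4 : s ^ 2 ≤ 4 * 10 ^ 10 * t ^ 2 + 8 * 10 ^ 10 * t + 4 * 10 ^ 10 := by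
    have := Nat.pow_le_pow_left ht2.le 2
    nlinarith
  have e1 : (r - 1) ^ 2 = s ^ 2 + 2 * (10 ^ 23 - 1) * s + (10 ^ 23 - 1) ^ 2 := by
    rw [show r - 1 = s + (10 ^ 23 - 1) by lia]
    ring
  have e2 : r ^ 2 = s ^ 2 + 2 * 10 ^ 23 * s + 10 ^ 46 := by
    rw [hrs]
    ring
  have e3 : t * (2 * t + 1) = 2 * t ^ 2 + t := by ring
  have k1 : t * (2 * t + 1) ≤ Y.colSum t := by
    by_contra! hlt
    have h3 := H t (2 * t + 1) (by nlinarith) (by lia)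
    have h4 : t * Y.colLen t ≤ Y.colSum t := by
      have := Finset.card_nsmul_le_sum (Finset.range t) Y.colLen (Y.colLen t)
        (fun j hj => Y.colLen_anti j _ (Finset.mem_range.1 hj).le)
      simpa [colSum] using this
    have h5 : t * (2 * t + 1) ≤ t * Y.colLen t := Nat.mul_le_mul_left _ (by lia)
    lia
  obtain ⟨Y', hY, X, hX, hL, hc⟩ := exists_le_linked_grid (Y := Y) (r := r) (t := t) (N := 99999)
    (x := x) (X₁ := 2 * 400 * r) (X₂ := 2 * 10 ^ 12 * r) (by norm_num) (by lia) k1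
    (by rw [e3]; norm_num at *; linarith) (by norm_num at *; lia) hx1
    (by norm_num at *; linarith) (by rw [e3]; norm_num at *; linarith) (by lia)
  refine ⟨Y', hY, X, hX, X, hX, hL, ?_⟩
  rw [hc, e3]
  norm_num at *
  linarith

/-- Every diagram is a constituent of a product of two subdiagrams of a staircase of about its
size, up to a bounded multiple of the square root of its size. -/
theorem exists_nearStair : ∃ C : ℕ, ∀ r (Y : YoungDiagram), 2 * Y.card ≤ r ^ 2 →
    NearStair r (C * r) Y := by
  refine ⟨10 ^ 26, fun r => ?_⟩
  induction r using Nat.strong_induction_on with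
  | _ r ih =>
    intro Y h2
    rcases le_or_gt (2 * Y.card) ((r - 1) ^ 2) with h1 | h1
    · rcases Nat.eq_zero_or_pos r with h0 | h0
      · subst h0
        exact nearStair_of_card_le (by lia)
      · exact (ih (r - 1) (by lia) Y h1).mono (by lia) (by lia)
    rcases lt_or_ge r (10 ^ 25) with hr | hr
    · refine nearStair_of_card_le ?_
      have : r ^ 2 ≤ 10 ^ 25 * r := by
        rw [sq]
        exact Nat.mul_le_mul_right _ hr.le
      lia
    by_contra hcon
    refine hcon (nearStair_of_no_head hr h1 h2 (fun x q hx hq => ?_) fun x q hx hq => ?_)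
    · by_contra! hlt
      exact hcon (nearStair_of_head (m := 10 ^ 12) (by norm_num) ih h1 h2 hx hq hlt)
    · by_contra! hlt
      rw [← card_transpose] at h1 h2
      have := (nearStair_of_head (m := 10 ^ 12) (by norm_num) ih h1 h2 hx hq hlt).transpose
      rw [transpose_transpose] at this
      exact hcon this

section FinsetCounting

open Finset

section Complete

variable {α : Type} [Fintype α] [DecidableEq α]

lemma E_conj (r c : α → ℕ) (x g : Perm α) :
    E r c (x * g * x⁻¹) = E (r ∘ x) (c ∘ x) g := by
  unfold E
  rw [← ec_comp_equiv x]
  congr 1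
  ext p
  simp

lemma exists_isTab_of_card (Y : YoungDiagram) (h : Y.card = Fintype.card α) :
    ∃ r c : α → ℕ, IsTab Y r c := by
  obtain ⟨e⟩ : Nonempty (α ≃ Y.cells) := by
    rw [← Fintype.card_eq, Fintype.card_coe]
    exact h.symm
  refine ⟨fun p => (e p).1.1, fun p => (e p).1.2, fun p q h1 h2 => ?_, fun p => ?_,
    fun i j hij => ?_⟩
  · exact e.injective (Subtype.ext (Prod.ext h1 h2))
  · exact (mem_cells _).1 (e p).2
  · exact ⟨e.symm ⟨(i, j), (mem_cells _).2 hij⟩, by simp, by simp⟩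

lemma IsTab.exists_equiv {Y : YoungDiagram} {r c r' c' : α → ℕ} (h : IsTab Y r c)
    (h' : IsTab Y r' c') : ∃ e : Perm α, r' = r ∘ e ∧ c' = c ∘ e := by
  choose e he₁ he₂ using fun p => h.surj _ _ (h'.mem p)
  have hinj : Function.Injective e := fun p q hpq =>
    h'.inj p q (by rw [← he₁, ← he₁, hpq]) (by rw [← he₂, ← he₂, hpq])
  exact ⟨Equiv.ofBijective e (Finite.injective_iff_bijective.1 hinj),
    funext fun p => (he₁ p).symm, funext fun p => (he₂ p).symm⟩

lemma IsTab.card_lt_le_of_sum_ne_zero {Z : YoungDiagram} {r c r' c' : α → ℕ} (h' : IsTab Z r' c')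
    (hs : ∑ g, E r c g * E r' c' g ≠ 0) (k : ℕ) :
    #{p | r p < k} ≤ #{p | r' p < k} := by
  have key : ∑ g, E r c g * ∑ b : Perm α, (if r ∘ b = r then E r' c' (b * g) else 0) =
      ∑ b : Perm α, if r ∘ b = r then ∑ g, E r c g * E r' c' g else 0 := by
    simp_rw [mul_sum]
    rw [sum_comm]
    refine sum_congr rfl fun b _ => ?_
    split_ifs with hb
    · refine Fintype.sum_equiv (Equiv.mulLeft b) _ _ fun g => ?_
      rw [Equiv.coe_mulLeft, E_row_mul r c hb]
    · simp
  set f : Perm α → ℂ := fun g => ∑ b : Perm α, (if r ∘ b = r then E r' c' (b * g) else 0) with hf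
  have hne : ∑ g, E r c g * f g ≠ 0 := by
    rw [key, ← sum_filter, sum_const, nsmul_eq_mul]
    refine mul_ne_zero ?_ hs
    have : (1 : Perm α) ∈ ({b | r ∘ b = r} : Finset (Perm α)) := by simp
    exact_mod_cast (card_pos.2 ⟨_, this⟩).ne'
  obtain ⟨g, -, hg⟩ := exists_ne_zero_of_sum_ne_zero hne
  have hfg : f g ≠ 0 := right_ne_zero_of_mul hg
  have h1 : ∀ b g : Perm α, r ∘ b = r → f (b * g) = f g := by
    intro b g hb
    simp only [hf]
    refine Fintype.sum_equiv (Equiv.mulRight b) _ _ fun x => ?_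
    have : r ∘ (x * b : Perm α) = r ↔ r ∘ x = r := by
      rw [Perm.coe_mul, ← Function.comp_assoc]
      refine ⟨fun h => ?_, fun h => by rw [h, hb]⟩
      have e : r ∘ (b⁻¹ : Perm α) = r := comp_inv_eq hb
      have := congrArg (· ∘ (b⁻¹ : Perm α)) h
      simp only [Function.comp_assoc] at this
      rw [e, ← Perm.coe_mul, mul_inv_cancel] at this
      simpa using this
    rw [Equiv.coe_mulRight]
    simp only [this, mul_assoc]
  have h2 : ∀ a g : Perm α, c' ∘ a = c' → f (g * a) = sg a * f g := by
    intro a g ha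
    simp only [hf]
    rw [mul_sum]
    refine sum_congr rfl fun b _ => ?_
    rw [← mul_assoc, E_mul_col r' c' ha]
    split_ifs <;> simp
  have hinj : ∀ p q, c' p = c' q → (r ∘ g) p = (r ∘ g) q → p = q := by
    intro p q hc hr
    by_contra hpq
    exact hfg (eq_zero_of_collision h1 h2 hpq hc hr)
  rw [← card_comp_perm g]
  exact h'.dominance hinj k

lemma IsTab.eq_of_sum_ne_zero {Y Z : YoungDiagram} {r c r' c' : α → ℕ} (h : IsTab Y r c)
    (h' : IsTab Z r' c') (hs : ∑ g, E r c g * E r' c' g ≠ 0) : Y = Z := by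
  have e1 := h'.card_lt_le_of_sum_ne_zero hs
  have e2 := h.card_lt_le_of_sum_ne_zero (r := r') (c := c') (by simpa only [mul_comm] using hs)
  have split : ∀ (r : α → ℕ) k, #{p | r p < k + 1} = #{p | r p < k} + #{p | r p = k} := by
    intro r k
    rw [← card_union_of_disjoint]
    · congr 1
      ext p
      simp only [mem_filter, mem_univ, true_and, mem_union]
      lia
    · rw [disjoint_filter]
      lia
  refine ext_rowLen fun i => ?_
  rw [h.rowLen_eq, h'.rowLen_eq]
  have := split r i
  have := split r' i
  have := e1 i
  have := e2 i
  have := e1 (i + 1)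
  have := e2 (i + 1)
  lia

end Complete

section Count

/-- The Young diagram of a multiset of numbers at most `N`: the columns are the elements. -/
noncomputable def diagramOf (m : Multiset ℕ) (N : ℕ) : YoungDiagram :=
  ofFun (fun i => m.countP (i < ·)) (fun i j hij => by
    simp only [Multiset.countP_eq_card_filter]
    exact Multiset.card_le_card (Multiset.monotone_filter_right _ fun x hx => hij.trans_lt hx)) N

lemma rowLen_diagramOf {m : Multiset ℕ} {N : ℕ} (h : ∀ x ∈ m, x ≤ N) (i : ℕ) :
    (diagramOf m N).rowLen i = m.countP (i < ·) :=
  rowLen_ofFun _ (by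
    rw [Multiset.countP_eq_zero]
    intro x hx
    have := h x hx
    lia) i

lemma sum_countP_lt {m : Multiset ℕ} {N : ℕ} (h : ∀ x ∈ m, x ≤ N) :
    ∑ i ∈ range N, m.countP (i < ·) = m.sum := by
  induction m using Multiset.induction_on with
  | empty => simp
  | cons a m ih =>
    simp only [Multiset.countP_cons, sum_add_distrib, Multiset.sum_cons]
    rw [ih fun x hx => h x (Multiset.mem_cons_of_mem hx), add_comm, add_left_inj]
    have ha := h a (Multiset.mem_cons_self a m)
    rw [← card_filter]
    refine (congrArg card ?_).trans (card_range a)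
    ext x
    simp only [mem_filter, mem_range]
    lia

lemma card_diagramOf {m : Multiset ℕ} {N : ℕ} (h : ∀ x ∈ m, x ≤ N) :
    (diagramOf m N).card = m.sum := by
  rw [← sum_rowLen_eq_card (N := N), ← sum_countP_lt h]
  · exact sum_congr rfl fun i _ => rowLen_diagramOf h i
  · rw [colLen_le_iff, rowLen_diagramOf h, Nat.le_zero, Multiset.countP_eq_zero]
    intro x hx
    have := h x hx
    lia

lemma diagramOf_injective {m m' : Multiset ℕ} {N : ℕ} (h : ∀ x ∈ m, x ≤ N) (h' : ∀ x ∈ m', x ≤ N)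
    (h0 : 0 ∉ m) (h0' : 0 ∉ m') (he : diagramOf m N = diagramOf m' N) : m = m' := by
  have hc : ∀ i, m.countP (i < ·) = m'.countP (i < ·) := fun i => by
    rw [← rowLen_diagramOf h, he, rowLen_diagramOf h']
  have split : ∀ (m : Multiset ℕ) i, m.countP (i < ·) = m.count (i + 1) + m.countP (i + 1 < ·) := by
    intro m i
    induction m using Multiset.induction_on with
    | empty => simp
    | cons a m ih =>
      rw [Multiset.countP_cons, Multiset.countP_cons, Multiset.count_cons, ih]
      split_ifs <;> lia
  ext i
  rcases i with _ | i
  · rw [Multiset.count_eq_zero_of_notMem h0, Multiset.count_eq_zero_of_notMem h0']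
  · have := split m i
    have := split m' i
    have := hc i
    have := hc (i + 1)
    lia

variable (α : Type) [Fintype α] [DecidableEq α]

/-- There are at least as many Young diagrams as conjugacy classes of permutations. -/
lemma exists_diagram_injective : ∃ D : ConjClasses (Perm α) → YoungDiagram,
    Function.Injective D ∧ ∀ C, (D C).card = Fintype.card α := by
  have hle : ∀ (p : (Fintype.card α).Partition), ∀ x ∈ p.parts, x ≤ Fintype.card α := fun p x hx =>
    p.parts_sum ▸ Multiset.le_sum_of_mem hx
  have h0 : ∀ (p : (Fintype.card α).Partition), 0 ∉ p.parts := fun p h => by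
    simpa using p.parts_pos h
  refine ⟨fun C => diagramOf (C.out.partition.parts) (Fintype.card α), fun C C' h => ?_,
    fun C => by rw [card_diagramOf (hle _), Nat.Partition.parts_sum]⟩
  have h1 := diagramOf_injective (hle _) (hle _) (h0 _) (h0 _) h
  have h2 := Perm.partition_eq_of_isConj.2 (Nat.Partition.ext h1)
  rw [← ConjClasses.mk_eq_mk_iff_isConj] at h2
  rwa [← C.out_eq, ← C'.out_eq]

end Count

section Classes

variable {α : Type} [Fintype α] [DecidableEq α]

/-- The sums of `f` over the conjugacy classes. -/
noncomputable def classSum (f : Perm α → ℂ) (C : ConjClasses (Perm α)) : ℂ :=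
  open Classical in ∑ g, if ConjClasses.mk g = C then f g else 0

lemma sum_mul_classSum (f : Perm α → ℂ) (F : ConjClasses (Perm α) → ℂ) :
    ∑ C, F C * classSum f C = ∑ g, f g * F (ConjClasses.mk g) := by
  classical
  simp only [classSum, mul_sum]
  rw [sum_comm]
  refine sum_congr rfl fun g _ => ?_
  rw [sum_eq_single (ConjClasses.mk g)]
  · simp [mul_comm]
  · intro C _ h
    rw [if_neg h.symm, mul_zero]
  · simp

/-- The average of a function over conjugacy classes (unnormalised). -/
noncomputable def conjSum (f : Perm α → ℂ) (g : Perm α) : ℂ := ∑ x : Perm α, f (x * g * x⁻¹)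

lemma conjSum_of_isConj (f : Perm α → ℂ) {g g' : Perm α} (h : IsConj g g') :
    conjSum f g = conjSum f g' := by
  obtain ⟨y, rfl⟩ := isConj_iff.1 h
  symm
  refine Fintype.sum_equiv (Equiv.mulRight y) _ _ fun x => ?_
  simp [mul_assoc]

lemma exists_conjSum_lift (f : Perm α → ℂ) :
    ∃ F : ConjClasses (Perm α) → ℂ, ∀ g, F (ConjClasses.mk g) = conjSum f g :=
  ⟨fun C => conjSum f C.out, fun g => conjSum_of_isConj f (by
    rw [← ConjClasses.mk_eq_mk_iff_isConj]
    exact Quotient.out_eq _)⟩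

lemma conj_sum_mul_eq (f f' : Perm α → ℂ) (x : Perm α) :
    ∑ g, f (x * g * x⁻¹) * f' g = ∑ g, f g * f' (x⁻¹ * g * x) := by
  refine Fintype.sum_equiv (MulAut.conj x).toEquiv _ _ fun g => ?_
  simp [mul_assoc]

lemma IsTab.sum_mul_conjSum {Y : YoungDiagram} {r c : α → ℕ} (h : IsTab Y r c) :
    ∑ g, E r c g * conjSum (E r c) g ≠ 0 := by
  set ψ := conjSum (E r c) with hψ
  have e1 : ∑ x : Perm α, ∑ g, E r c g * ψ g = ∑ g, ψ g * ψ g := by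
    have : ∀ x : Perm α, ∑ g, E r c g * ψ g = ∑ g, E r c (x * g * x⁻¹) * ψ g := by
      intro x
      rw [conj_sum_mul_eq]
      refine sum_congr rfl fun g _ => ?_
      rw [hψ, conjSum_of_isConj (E r c) (isConj_iff.2 ⟨x⁻¹, by simp⟩ : IsConj g (x⁻¹ * g * x))]
    rw [sum_congr rfl fun x _ => this x, sum_comm]
    refine sum_congr rfl fun g _ => ?_
    rw [← sum_mul]
    rfl
  intro h0
  rw [h0] at e1
  have e2 : ∀ g, ψ g * ψ g = ((‖ψ g‖ ^ 2 : ℝ) : ℂ) := fun g => by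
    have : (starRingEnd ℂ) (ψ g) = ψ g := by simp [hψ, conjSum, conj_E]
    nth_rewrite 1 [← this]
    rw [Complex.conj_mul', Complex.ofReal_pow]
  simp only [e2, sum_const_zero] at e1
  rw [← Complex.ofReal_sum, eq_comm, Complex.ofReal_eq_zero,
    sum_eq_zero_iff_of_nonneg fun g _ => by positivity] at e1
  have e3 := e1 1 (mem_univ _)
  have e4 : ψ 1 = Fintype.card (Perm α) := by
    simp [hψ, conjSum, h.E_one]
  rw [e4] at e3
  simp at e3

/-- The class sums of the functions `E` separate functions on conjugacy classes. -/
lemma exists_sum_E_ne_zero {F : ConjClasses (Perm α) → ℂ} (hF : F ≠ 0) :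
    ∃ Y r c, IsTab (α := α) Y r c ∧ ∑ g, E r c g * F (ConjClasses.mk g) ≠ 0 := by
  classical
  obtain ⟨D, hD, hDc⟩ := exists_diagram_injective α
  choose r c h using fun C => exists_isTab_of_card (α := α) (D C) (hDc C)
  by_contra! hcon
  have hli : LinearIndependent ℂ fun C => classSum (E (r C) (c C)) := by
    rw [Fintype.linearIndependent_iff]
    intro a ha C
    obtain ⟨K, hK⟩ := exists_conjSum_lift (E (r C) (c C))
    have e1 : ∑ C', K C' * (∑ B, a B • classSum (E (r B) (c B))) C' = 0 := by
      rw [ha]; simp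
    have e2 : ∀ B, ∑ C', K C' * classSum (E (r B) (c B)) C' =
        ∑ g, E (r B) (c B) g * conjSum (E (r C) (c C)) g := fun B => by
      rw [sum_mul_classSum]
      simp only [hK]
    have e3 : ∑ B, a B * ∑ C', K C' * classSum (E (r B) (c B)) C' = 0 := by
      rw [← e1]
      simp only [Finset.sum_apply, Pi.smul_apply, smul_eq_mul, mul_sum]
      rw [sum_comm]
      exact sum_congr rfl fun _ _ => sum_congr rfl fun _ _ => by ring
    rw [sum_eq_single C] at e3
    · rw [e2] at e3
      exact (mul_eq_zero.1 e3).resolve_right (h C).sum_mul_conjSum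
    · intro B _ hB
      rw [e2, mul_eq_zero]
      right
      simp only [conjSum, mul_sum]
      rw [sum_comm]
      refine sum_eq_zero fun x _ => ?_
      simp only [E_conj]
      by_contra hne
      exact hB (hD ((h B).eq_of_sum_ne_zero ((h C).comp x) hne))
    · simp
  have hspan := hli.span_eq_top_of_card_eq_finrank' (by simp)
  refine hF ?_
  have hker : ∀ G : ConjClasses (Perm α) → ℂ, ∑ C, F C * G C = 0 := by
    intro G
    have hG : G ∈ Submodule.span ℂ (Set.range fun C => classSum (E (r C) (c C))) := by
      rw [hspan]; trivial
    induction hG using Submodule.span_induction with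
    | mem x hx =>
      obtain ⟨C, rfl⟩ := hx
      rw [sum_mul_classSum]
      exact hcon _ _ _ (h C)
    | zero => simp
    | add x y _ _ hx hy => simp [mul_add, sum_add_distrib, hx, hy]
    | smul a x _ hx =>
      simp only [Pi.smul_apply, smul_eq_mul, mul_left_comm _ a, ← mul_sum, hx, mul_zero]
  funext C
  classical
  simpa [Pi.single_apply] using hker (Pi.single C 1)

/-- Every nonzero space of functions stable under translations on both sides contains all translates
of the functions `E` for some shape. -/
theorem exists_fam_subset (S : Submodule ℂ (Perm α → ℂ))
    (hS : ∀ f ∈ S, ∀ x y : Perm α, (fun g => f (x * g * y)) ∈ S) {f : Perm α → ℂ} (hf : f ∈ S)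
    (hf1 : f 1 ≠ 0) : ∃ Y : YoungDiagram, Y.card = Fintype.card α ∧ Fam α Y ⊆ S := by
  obtain ⟨F, hF⟩ := exists_conjSum_lift f
  have hsum : ∀ {ι : Type} (s : Finset ι) (φ : ι → Perm α → ℂ), (∀ i ∈ s, φ i ∈ S) →
      (fun g => ∑ i ∈ s, φ i g) ∈ S := by
    intro ι s φ h
    convert S.sum_mem h using 1
    funext g
    simp
  have hF0 : F ≠ 0 := fun h0 => by
    have := hF 1
    simp [h0, conjSum, hf1] at this
  obtain ⟨Y, r, c, h, hne⟩ := exists_sum_E_ne_zero hF0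
  set u : Perm α → ℂ := fun g => ∑ a : Perm α, ∑ b : Perm α,
    (if c ∘ a = c then sg a else 0) * ((if r ∘ b = r then 1 else 0) * conjSum f (b * g * a)) with hu
  have hcS : conjSum f ∈ S := hsum _ _ fun x _ => hS f hf _ _
  have huS : u ∈ S := hsum _ _ fun a _ => hsum _ _ fun b _ =>
    S.smul_mem _ (S.smul_mem _ (hS _ hcS b a))
  have hu1 : u 1 ≠ 0 := by
    convert hne using 1
    simp only [hF, E, ec, sum_mul, hu]
    rw [sum_comm (s := univ (α := Perm α)) (t := univ (α := Perm α))
      (f := fun g a => (if c ∘ a = c ∧ r ∘ g = r ∘ a then sg a else 0) * conjSum f g)]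
    refine sum_congr rfl fun a _ => ?_
    refine Fintype.sum_equiv (Equiv.mulRight a) _ _ fun b => ?_
    have : r ∘ (b * a : Perm α) = r ∘ a ↔ r ∘ b = r := by
      rw [Perm.coe_mul, ← Function.comp_assoc]
      exact a.surjective.injective_comp_right.eq_iff
    rw [Equiv.coe_mulRight]
    simp only [this, mul_one]
    by_cases h1 : c ∘ a = c <;> by_cases h2 : r ∘ b = r <;> simp [h1, h2]
  have hur : ∀ b g : Perm α, r ∘ b = r → u (b * g) = u g := by
    intro b g hb
    refine sum_congr rfl fun a _ => ?_
    refine Fintype.sum_equiv (Equiv.mulRight b) _ _ fun x => ?_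
    have : r ∘ (x * b : Perm α) = r ↔ r ∘ x = r := by
      nth_rewrite 2 [← hb]
      rw [Perm.coe_mul, ← Function.comp_assoc]
      exact b.surjective.injective_comp_right.eq_iff
    rw [Equiv.coe_mulRight]
    simp only [this, mul_assoc]
  have huc : ∀ a g : Perm α, c ∘ a = c → u (g * a) = sg a * u g := by
    intro a g ha
    simp only [hu]
    rw [mul_sum]
    refine Fintype.sum_equiv (Equiv.mulLeft a) _ _ fun x => ?_
    have : c ∘ (a * x : Perm α) = c ↔ c ∘ x = c := by
      rw [Perm.coe_mul, ← Function.comp_assoc, ha]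
    rw [Equiv.coe_mulLeft, mul_sum]
    refine sum_congr rfl fun b _ => ?_
    simp only [this, mul_assoc, sg_mul]
    have := sg_mul_self a
    by_cases h1 : c ∘ x = c <;> by_cases h2 : r ∘ b = r <;> simp only [h1, h2, if_true, if_false]
    · linear_combination (-sg x * conjSum f (b * (g * (a * x)))) * this
    all_goals simp
  have hE : E r c ∈ S := by
    have : E r c = (u 1)⁻¹ • u := funext fun g => by
      rw [Pi.smul_apply, smul_eq_mul, h.eq_smul_E hur huc g, inv_mul_cancel_left₀ hu1]
    rw [this]
    exact S.smul_mem _ huS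
  refine ⟨Y, h.card_eq.symm, ?_⟩
  rintro _ ⟨r', c', h', x, rfl⟩
  obtain ⟨e, rfl, rfl⟩ := h.exists_equiv h'
  simp only [← E_conj]
  have := hS _ hE (e * x) e⁻¹
  simpa only [mul_assoc, SetLike.mem_coe] using this

end Classes

end FinsetCounting

section Rep

variable {G : Type} [Group G]

/-- The morphism of representations given by an equivariant linear map. -/
noncomputable def homOfLinear {A B : FDRep ℂ G} (T : A →ₗ[ℂ] B)
    (hT : ∀ g v, T (A.ρ g v) = B.ρ g (T v)) : A ⟶ B :=
  ⟨InducedCategory.homMk (ModuleCat.ofHom T), fun g => by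
    ext1
    ext v
    exact hT g v⟩

/-- The linear map underlying a morphism of representations. -/
noncomputable def linearOfHom {A B : FDRep ℂ G} (φ : A ⟶ B) : A →ₗ[ℂ] B := φ.hom.hom.hom

lemma linearOfHom_apply {A B : FDRep ℂ G} (φ : A ⟶ B) (g : G) (v : A) :
    linearOfHom φ (A.ρ g v) = B.ρ g (linearOfHom φ v) :=
  ConcreteCategory.congr_hom ((forget (FGModuleCat ℂ)).congr_map (φ.comm g)) v

lemma linearOfHom_injective {A B : FDRep ℂ G} :
    Function.Injective (linearOfHom : (A ⟶ B) → (A →ₗ[ℂ] B)) := by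
  intro φ ψ h
  ext x
  exact LinearMap.congr_fun h x

lemma homOfLinear_ne_zero {A B : FDRep ℂ G} {T : A →ₗ[ℂ] B}
    {hT : ∀ g v, T (A.ρ g v) = B.ρ g (T v)} (h : T ≠ 0) : homOfLinear T hT ≠ 0 :=
  fun h0 => h (congrArg linearOfHom h0)

/-- `f` is a matrix coefficient of the representation `A`. -/
def IsCoef (A : FDRep ℂ G) (f : G → ℂ) : Prop :=
  ∃ (φ : Module.Dual ℂ A) (v : A), ∀ g, f g = φ (A.ρ g v)

lemma isCoef_of {V : Type} [AddCommGroup V] [Module ℂ V] [Module.Finite ℂ V]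
    (ρ : Representation ℂ G V) (φ : Module.Dual ℂ V) (v : V) :
    IsCoef (FDRep.of ρ) fun g => φ (ρ g v) :=
  ⟨φ, v, fun _ => rfl⟩

lemma IsCoef.tensor {A B : FDRep ℂ G} {f f' : G → ℂ} (h : IsCoef A f) (h' : IsCoef B f') :
    IsCoef (A ⊗ B) fun g => f g * f' g := by
  obtain ⟨φ, v, hf⟩ := h
  obtain ⟨φ', v', hf'⟩ := h'
  refine ⟨(LinearMap.mul' ℂ ℂ ∘ₗ TensorProduct.map φ φ' :), v ⊗ₜ[ℂ] v', fun g => ?_⟩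
  simp only [hf, hf']
  rfl

lemma isCoef_unit : IsCoef (𝟙_ (FDRep ℂ G)) fun _ => 1 :=
  ⟨(LinearMap.id : ℂ →ₗ[ℂ] ℂ), (1 : ℂ), fun _ => rfl⟩

lemma exists_hom_ne_zero [Fintype G] {W U : FDRep ℂ G} {f : G → ℂ} (hf : IsCoef U f)
    (φ : Module.Dual ℂ W) (w : W) (h : ∑ g, f g * φ (W.ρ g⁻¹ w) ≠ 0) : ∃ F : W ⟶ U, F ≠ 0 := by
  obtain ⟨ψ, u, hf⟩ := hf
  let T : W →ₗ[ℂ] U := ∑ g, (φ ∘ₗ W.ρ g⁻¹).smulRight (U.ρ g u)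
  have hTa : ∀ w, T w = ∑ g, φ (W.ρ g⁻¹ w) • U.ρ g u := fun w => by simp [T]
  have hT : ∀ g w, T (W.ρ g w) = U.ρ g (T w) := fun g w => by
    rw [hTa, hTa, map_sum]
    refine (Fintype.sum_equiv (Equiv.mulLeft g) _ _ fun x => ?_).symm
    rw [map_smul, Equiv.coe_mulLeft, map_mul, mul_inv_rev, map_mul, Module.End.mul_apply,
      Module.End.mul_apply, ← Module.End.mul_apply (W.ρ g⁻¹), ← map_mul, inv_mul_cancel, map_one,
      Module.End.one_apply]
  refine ⟨homOfLinear T hT, homOfLinear_ne_zero fun h0 => h ?_⟩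
  have := congrArg ψ (hTa w)
  rw [h0, LinearMap.zero_apply, map_zero, map_sum] at this
  rw [this]
  refine Finset.sum_congr rfl fun g _ => ?_
  rw [map_smul, smul_eq_mul, hf, mul_comm]

/-- The span of the matrix coefficients of the dual of `W`. -/
def dualCoefs (W : FDRep ℂ G) : Submodule ℂ (G → ℂ) :=
  Submodule.span ℂ {f | ∃ (φ : Module.Dual ℂ W) (w : W), f = fun g => φ (W.ρ g⁻¹ w)}

lemma translate_mem_dualCoefs {W : FDRep ℂ G} {f : G → ℂ} (hf : f ∈ dualCoefs W) (x y : G) :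
    (fun g => f (x * g * y)) ∈ dualCoefs W := by
  have h := Submodule.mem_map_of_mem (f := LinearMap.funLeft ℂ ℂ fun g => x * g * y) hf
  rw [dualCoefs, Submodule.map_span] at h
  refine Submodule.span_mono ?_ h
  rintro _ ⟨_, ⟨φ, w, rfl⟩, rfl⟩
  refine ⟨φ ∘ₗ W.ρ y⁻¹, W.ρ x⁻¹ w, funext fun g => ?_⟩
  simp [LinearMap.funLeft, mul_assoc]

lemma exists_mem_dualCoefs (W : FDRep ℂ G) [Simple W] : ∃ f ∈ dualCoefs W, f 1 ≠ 0 := by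
  obtain ⟨w, hw⟩ : ∃ w : W, w ≠ 0 := by
    by_contra! h
    refine id_nonzero W (linearOfHom_injective (LinearMap.ext fun w => ?_))
    rw [h w, map_zero, map_zero]
  obtain ⟨φ, hφ⟩ : ∃ φ : Module.Dual ℂ W, φ w ≠ 0 := by
    by_contra! h
    exact hw ((Module.forall_dual_apply_eq_zero_iff ℂ w).1 h)
  refine ⟨_, Submodule.subset_span ⟨φ, w, rfl⟩, ?_⟩
  simpa using hφ

/-- The right regular representation, on functions. -/
def rightRep (G : Type) [Group G] : Representation ℂ G (G → ℂ) where
  toFun y := LinearMap.funLeft ℂ ℂ (· * y)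
  map_one' := by ext; simp [LinearMap.funLeft]
  map_mul' x y := by
    refine LinearMap.ext fun f => funext fun g => ?_
    simp [LinearMap.funLeft, mul_assoc]

lemma rightRep_apply (y : G) (f : G → ℂ) (g : G) : rightRep G y f g = f (g * y) := rfl

/-- The subrepresentation of functions generated by `f`. -/
def cyclicSub (f : G → ℂ) : Subrepresentation (rightRep G) where
  toSubmodule := Submodule.span ℂ (Set.range fun y => rightRep G y f)
  apply_mem_toSubmodule y v hv := by
    have h := Submodule.mem_map_of_mem (f := rightRep G y) hv
    rw [Submodule.map_span] at h
    refine Submodule.span_mono ?_ h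
    rintro _ ⟨_, ⟨z, rfl⟩, rfl⟩
    exact ⟨y * z, by simp⟩

/-- The representation generated by a function `f` on the group. -/
noncomputable def cyclicRep [Finite G] (f : G → ℂ) : FDRep ℂ G :=
  FDRep.of (cyclicSub f).toRepresentation

lemma isCoef_cyclicRep [Finite G] (f : G → ℂ) (x y : G) :
    IsCoef (cyclicRep f) fun g => f (x * g * y) :=
  isCoef_of _ (LinearMap.proj x ∘ₗ (cyclicSub f).toSubmodule.subtype)
    ⟨rightRep G y f, Submodule.subset_span ⟨y, rfl⟩⟩

end Rep

section Specht

variable {α : Type} [Fintype α] [DecidableEq α]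

theorem IsTab.simple_cyclicRep {Y : YoungDiagram} {r c : α → ℕ} (h : IsTab Y r c) :
    Simple (cyclicRep (E r c)) := by
  set M := (cyclicSub (E r c)).toSubmodule
  have hM : ∀ {b : Perm α}, r ∘ b = r → ∀ f ∈ M, ∀ g, f (b * g) = f g := by
    intro b hb f hf g
    induction hf using Submodule.span_induction with
    | mem f hf =>
      obtain ⟨y, rfl⟩ := hf
      simp only [rightRep_apply, mul_assoc, E_row_mul r c hb]
    | zero => rfl
    | add f f' _ _ hf hf' => rw [Pi.add_apply, Pi.add_apply, hf, hf']
    | smul a f _ hf => rw [Pi.smul_apply, Pi.smul_apply, hf]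
  have hmem : ∀ y, rightRep _ y (E r c) ∈ M := fun y => Submodule.subset_span ⟨y, rfl⟩
  let e : M := ⟨E r c, by simpa using hmem 1⟩
  rw [FDRep.simple_iff_end_is_rank_one, finrank_eq_one_iff_of_nonzero' (𝟙 _)]
  · intro φ
    let T : M →ₗ[ℂ] M := linearOfHom φ
    have hT : ∀ y (v : M), T ((cyclicSub (E r c)).toRepresentation y v) =
        (cyclicSub (E r c)).toRepresentation y (T v) := linearOfHom_apply φ
    have hE : T e = (T e).1 1 • e := Subtype.ext <| funext fun g => by
      refine h.eq_smul_E (fun b g hb => hM hb _ (T e).2 g) (fun a g ha => ?_) g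
      have h1 := hT a e
      have h2 : (cyclicSub (E r c)).toRepresentation a e = sg a • e :=
        Subtype.ext (funext fun g => E_mul_col r c ha g)
      rw [h2, map_smul] at h1
      exact (congrFun (congrArg Subtype.val h1) g).symm
    have hTs : (T e).1 1 • LinearMap.id = T := by
      rw [Submodule.linearMap_eq_iff_of_eq_span _ _ (rfl : M = _)]
      rintro ⟨_, y, rfl⟩
      have h1 := hT y e
      rw [hE, map_smul] at h1
      exact h1.symm
    exact ⟨(T e).1 1, linearOfHom_injective hTs⟩
  · intro h0
    have h1 := LinearMap.congr_fun (congrArg linearOfHom h0) e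
    have h2 : E r c 1 = 0 := congrFun (congrArg Subtype.val h1) 1
    rw [h.E_one] at h2
    exact one_ne_zero h2

lemma isCoef_of_mem_fam {Y : YoungDiagram} {r c : α → ℕ} (h : IsTab Y r c) {f : Perm α → ℂ}
    (hf : f ∈ Fam α Y) : IsCoef (cyclicRep (E r c)) f := by
  obtain ⟨r', c', h', x, rfl⟩ := hf
  obtain ⟨e, rfl, rfl⟩ := h.exists_equiv h'
  simp only [← E_conj]
  simpa only [mul_assoc] using isCoef_cyclicRep (E r c) (e * x) e⁻¹

end Specht

section Std

lemma isCoef_stdRep {n : ℕ} (i : Fin n) :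
    IsCoef (stdRep n) fun g => if g i = i then 1 else 0 := by
  have h := isCoef_of (Representation.ofMulAction ℂ (Perm (Fin n)) (Fin n))
    (Finsupp.lapply i ∘ₗ (MonoidAlgebra.coeffLinearEquiv ℂ).toLinearMap) (MonoidAlgebra.single i 1)
  refine (congrArg (IsCoef (stdRep n)) (funext fun g => ?_)).mp h
  simp [Representation.ofMulAction_single, Finsupp.single_apply]

lemma isCoef_tpow_stdRep {n k : ℕ} (x : Fin k → Fin n) :
    IsCoef (tpow (stdRep n) k) fun g => if ∀ i, g (x i) = x i then 1 else 0 := by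
  induction k with
  | zero => simpa using! isCoef_unit
  | succ k ih =>
    have h := (ih fun i => x i.castSucc).tensor (isCoef_stdRep (x (Fin.last k)))
    refine (congrArg (IsCoef (tpow (stdRep n) (k + 1))) (funext fun g => ?_)).mp h
    simp only [Fin.forall_fin_succ']
    split_ifs <;> simp_all

end Std

section Extend

variable {β D : Type} [Fintype β] [DecidableEq β] [Fintype D] [DecidableEq D]

lemma exists_sumCongr_eq {a : Perm (β ⊕ D)} (h : ∀ d, a (Sum.inr d) = Sum.inr d) :
    ∃ b : Perm β, Equiv.sumCongr b (1 : Perm D) = a := by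
  obtain ⟨⟨x, y⟩, hxy⟩ := Perm.mem_sumCongrHom_range_of_perm_mapsTo_inl (σ := a) (by
    rintro _ ⟨b, rfl⟩
    rcases hb : a (Sum.inl b) with b' | d
    · exact ⟨b', rfl⟩
    · have := a.injective (hb.trans (h d).symm)
      simp at this)
  refine ⟨x, ?_⟩
  have hy : y = 1 := Equiv.ext fun d => Sum.inr_injective (by
    rw [Perm.one_apply, ← h d, ← hxy]
    rfl)
  rw [← hxy, hy]
  rfl

lemma sumCongr_injective :
    Function.Injective fun b : Perm β => Equiv.sumCongr b (1 : Perm D) := fun _ _ h =>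
  Equiv.ext fun x => Sum.inl_injective (Equiv.congr_fun h (Sum.inl x))

lemma sg_sumCongr (b : Perm β) : sg (Equiv.sumCongr b (1 : Perm D) : Perm (β ⊕ D)) = sg b := by
  simp [sg]

lemma E_sumCongr {r c : β ⊕ D → ℕ} (hinj : ∀ p q, r p = r q → c p = c q → p = q) (g : Perm β) :
    E r c (Equiv.sumCongr g (1 : Perm D) : Perm (β ⊕ D)) = E (r ∘ Sum.inl) (c ∘ Sum.inl) g := by
  symm
  refine Fintype.sum_of_injective (fun b : Perm β => Equiv.sumCongr b (1 : Perm D))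
    sumCongr_injective _ _ (fun a ha => ?_) fun a => ?_
  · refine if_neg fun ⟨h1, h2⟩ => ha (exists_sumCongr_eq fun d => ?_)
    exact hinj _ _ (congrFun h2 (Sum.inr d)).symm (congrFun h1 (Sum.inr d))
  · rw [sg_sumCongr]
    refine if_congr ?_ rfl rfl
    simp [funext_iff, Sum.forall]

lemma IsTab.exists_extension {Y Y' : YoungDiagram} {r' c' : β → ℕ} (h : IsTab Y' r' c')
    (hY : Y' ≤ Y)
    (hc : Y.card = Fintype.card β + Fintype.card D) :
    ∃ r c : β ⊕ D → ℕ, IsTab Y r c ∧ r ∘ Sum.inl = r' ∧ c ∘ Sum.inl = c' := by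
  have hsub : Y'.cells ⊆ Y.cells := hY
  obtain ⟨e⟩ : Nonempty (D ≃ (Y.cells \ Y'.cells : Finset (ℕ × ℕ))) := by
    rw [← Fintype.card_eq, Fintype.card_coe, Finset.card_sdiff_of_subset hsub]
    have : Y'.cells.card = Fintype.card β := h.card_eq.symm
    have : Y.cells.card = Y.card := rfl
    lia
  have he : ∀ d, ((e d).1.1, (e d).1.2) ∈ Y ∧ ((e d).1.1, (e d).1.2) ∉ Y' := fun d =>
    Finset.mem_sdiff.1 (e d).2
  refine ⟨Sum.elim r' fun d => (e d).1.1, Sum.elim c' fun d => (e d).1.2, ⟨?_, ?_, ?_⟩, rfl, rfl⟩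
  · rintro (p | p) (q | q) h1 h2 <;> simp only [Sum.elim_inl, Sum.elim_inr] at h1 h2
    · rw [h.inj p q h1 h2]
    · exact absurd (h1 ▸ h2 ▸ h.mem p) (he q).2
    · exact absurd (h1.symm ▸ h2.symm ▸ h.mem q) (he p).2
    · rw [e.injective (Subtype.ext (Prod.ext h1 h2))]
  · rintro (p | p)
    · exact hY (h.mem p)
    · exact (he p).1
  · intro i j hij
    by_cases h' : (i, j) ∈ Y'
    · obtain ⟨p, hp⟩ := h.surj i j h'
      exact ⟨Sum.inl p, hp⟩
    · refine ⟨Sum.inr (e.symm ⟨(i, j), by simpa using ⟨hij, h'⟩⟩), ?_⟩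
      simp

lemma exists_fam_extension {α : Type} [Fintype α] [DecidableEq α] (e : β ⊕ D ≃ α)
    {Y Y' : YoungDiagram} (hY : Y' ≤ Y) (hc : Y.card = Fintype.card α) {f : Perm β → ℂ}
    (hf : f ∈ Fam β Y') :
    ∃ F ∈ Fam α Y, ∀ g : Perm β, F (e.permCongr (Equiv.sumCongr g 1)) = f g := by
  obtain ⟨r', c', h', x, rfl⟩ := hf
  obtain ⟨r, c, h, rfl, rfl⟩ := h'.exists_extension (D := D) hY (by
    rw [hc, ← Fintype.card_congr e, Fintype.card_sum])
  refine ⟨_, ⟨_, _, h.comp e.symm, e.permCongr (Equiv.sumCongr x 1), rfl⟩, fun g => ?_⟩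
  beta_reduce
  rw [← E_sumCongr h.inj]
  unfold E
  rw [← ec_comp_equiv e]
  congr 1
  · funext p; simp
  · funext p; simp
  · funext p
    rcases p with p | p <;> simp

end Extend

section Hom

theorem exists_hom_of_linked {n k : ℕ} {Z : YoungDiagram} {r c : Fin n → ℕ} (h : IsTab Z r c)
    (hL : ∀ Y : YoungDiagram, Y.card = n → ∃ Y' ≤ Y, ∃ U ≤ Z, ∃ V ≤ Z, Linked ![Y', U, V] ∧
      Y'.card < n ∧ n ≤ Y'.card + k) (W : FDRep ℂ (Perm (Fin n))) [Simple W] :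
    ∃ F : W ⟶ cyclicRep (E r c) ⊗ cyclicRep (E r c) ⊗ tpow (stdRep n) k, F ≠ 0 := by
  obtain ⟨f₀, hf₀, hf1⟩ := exists_mem_dualCoefs W
  obtain ⟨Y, hYc, hY⟩ := exists_fam_subset (dualCoefs W)
    (fun f hf x y => translate_mem_dualCoefs hf x y) hf₀ hf1
  obtain ⟨Y', hY', U, hU, V, hV, ⟨β, _, _, f, hf, hne⟩, h1, h2⟩ := hL Y (by simpa using hYc)
  have hβ : Y'.card = Fintype.card β := by
    obtain ⟨r, c, h, -⟩ := hf 0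
    exact h.card_eq.symm
  obtain ⟨d, rfl⟩ : ∃ d, n = Fintype.card β + (d + 1) := ⟨n - Y'.card - 1, by lia⟩
  obtain ⟨e⟩ : Nonempty (β ⊕ Fin (d + 1) ≃ Fin (Fintype.card β + (d + 1))) := by
    rw [← Fintype.card_eq]
    simp
  have hZ : Z.card = Fintype.card (Fin (Fintype.card β + (d + 1))) := h.card_eq.symm
  obtain ⟨F₀, hF₀, hF₀'⟩ := exists_fam_extension e hY' hYc (hf 0)
  obtain ⟨F₁, hF₁, hF₁'⟩ := exists_fam_extension e hU hZ (hf 1)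
  obtain ⟨F₂, hF₂, hF₂'⟩ := exists_fam_extension e hV hZ (hf 2)
  let x : Fin k → Fin (Fintype.card β + (d + 1)) :=
    fun j => e (Sum.inr ⟨min j d, by lia⟩)
  have hcoef := (isCoef_of_mem_fam h hF₁).tensor ((isCoef_of_mem_fam h hF₂).tensor
    (isCoef_tpow_stdRep x))
  obtain ⟨_, ⟨φ, w, rfl⟩, hs⟩ := exists_ne_zero_of_mem_span (hY hF₀)
    (pairing fun g => F₁ g * (F₂ g * if ∀ i, g (x i) = x i then 1 else 0)) (by
      rw [pairing_apply]
      convert hne using 1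
      symm
      refine Fintype.sum_of_injective (fun b : Perm β => e.permCongr (Equiv.sumCongr b 1))
        (e.permCongr.injective.comp sumCongr_injective) _ _ (fun a ha => ?_) fun a => ?_
      · rw [if_neg fun hx => ha ?_, mul_zero, mul_zero, zero_mul]
        obtain ⟨b, hb⟩ := exists_sumCongr_eq (a := e.permCongr.symm a) fun i => by
          have := hx ⟨i, by lia⟩
          have hi : min (i : ℕ) d = i := by lia
          simp only [x, hi] at this
          simp [this]
        exact ⟨b, (e.permCongr.symm_apply_eq.1 hb.symm).symm⟩
      · rw [hF₀', hF₁', hF₂', if_pos fun i => by simp [x], Fin.prod_univ_three]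
        ring)
  exact exists_hom_ne_zero hcoef φ w hs

end Hom

lemma card_stair (r : ℕ) : 2 * (stair r).card = r * (r + 1) := by
  rw [← sum_rowLen_eq_card (N := r) _ (by rw [colLen_le_iff, rowLen_stair]; lia)]
  simp only [rowLen_stair]
  induction r with
  | zero => rfl
  | succ r ih =>
    rw [Finset.sum_range_succ', mul_add]
    simp only [Nat.add_sub_add_right, ih]
    lia

lemma exists_le_card_eq_of_card_le {Y : YoungDiagram} {m : ℕ} (h : Y.card ≤ m) :
    ∃ Z, Y ≤ Z ∧ Z.card = m := by
  let X := ofFun (fun i => if i = 0 then m - Y.card else 0)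
    (fun i j hij => by dsimp only; split_ifs <;> lia) 1
  have hXr : ∀ i, X.rowLen i = if i = 0 then m - Y.card else 0 := rowLen_ofFun _ (by simp)
  refine ⟨rowAdd Y X, ?_, ?_⟩
  · rw [le_iff_rowLen]
    simp
  · rw [card_rowAdd, ← sum_rowLen_eq_card (Y := X) (N := 1) (by rw [colLen_le_iff, hXr]; simp)]
    simp [hXr]
    lia

/-- There is a constant `C > 0` such that for all sufficiently large `n` there is an
irreducible complex representation `V` of `S_n` such that every irreducible complex
representation of `S_n` is a constituent of `V ⊗ V ⊗ τ_n^{⊗⌈C√n⌉}`. -/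
theorem all_in_square_times_standard_power :
    ∃ C : ℝ, 0 < C ∧ ∃ N : ℕ, ∀ n : ℕ, N ≤ n →
      ∃ V : FDRep ℂ (Equiv.Perm (Fin n)), Simple V ∧
        ∀ W : FDRep ℂ (Equiv.Perm (Fin n)), Simple W →
          ∃ f : W ⟶ V ⊗ V ⊗ tpow (stdRep n) ⌈C * Real.sqrt n⌉₊, f ≠ 0 := by
  obtain ⟨C, hC⟩ := exists_nearStair
  refine ⟨2 * (C + 2), by positivity, 1, fun n hn => ?_⟩
  obtain ⟨R, hR⟩ : ∃ R, (2 * n).sqrt = R + 1 :=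
    Nat.exists_eq_add_one.2 (Nat.sqrt_pos.2 (by lia))
  have hR1 : (R + 1) * (R + 1) ≤ 2 * n := hR ▸ Nat.sqrt_le (2 * n)
  have hR2 : 2 * n < (R + 2) * (R + 2) := by
    have := Nat.lt_succ_sqrt (2 * n)
    rwa [hR] at this
  have hk : (C + 2) * (R + 1) ≤ ⌈(2 * (C + 2) : ℝ) * Real.sqrt n⌉₊ := by
    have h1 : ((R + 1 : ℕ) : ℝ) ≤ 2 * Real.sqrt n := by
      rw [← Real.sqrt_sq (by positivity : (0 : ℝ) ≤ 2 * Real.sqrt n)]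
      refine Real.le_sqrt_of_sq_le ?_
      rw [mul_pow, Real.sq_sqrt (by positivity)]
      have : ((R + 1 : ℕ) : ℝ) * (R + 1 : ℕ) ≤ 2 * n := by exact_mod_cast hR1
      nlinarith
    have h2 : (((C + 2) * (R + 1) : ℕ) : ℝ) ≤ 2 * (C + 2) * Real.sqrt n := by
      push_cast at h1 ⊢
      nlinarith
    exact_mod_cast h2.trans (Nat.le_ceil _)
  obtain ⟨Z, hZ, hZc⟩ := exists_le_card_eq_of_card_le (Y := stair R) (m := n) (by
    have := card_stair R
    nlinarith)
  obtain ⟨r, c, h⟩ := exists_isTab_of_card (α := Fin n) Z (by simpa using hZc)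
  refine ⟨cyclicRep (E r c), h.simple_cyclicRep, fun W _ =>
    exists_hom_of_linked h (fun Y hY => ?_) W⟩
  have hm : 2 * (R ^ 2 / 2) ≤ R ^ 2 ∧ R ^ 2 ≤ 2 * (R ^ 2 / 2) + 1 := by lia
  obtain ⟨X, hX, hXc⟩ := exists_le_card_eq (Y := Y) (m := R ^ 2 / 2) (by nlinarith)
  obtain ⟨Y', hY', U, hU, V, hV, hL, hw⟩ := hC R X (by lia)
  have := YoungDiagram.card_le_card hY'
  refine ⟨Y', hY'.trans hX, U, hU.trans hZ, V, hV.trans hZ, hL, by nlinarith, by nlinarith⟩
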